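/- arXiv:2202.13721 — 5 statements merged into one kernel-verified Lean document; each statement's English description precedes it below -/
import Mathlib

section
/- Let N ≥ 3 be an integer, 2* = 2N/(N−2), Ω ⊆ ℝ^N an open set, Q ∈ C¹(Ω), ε ≥ 0, s ≥ 1, and let u ∈ C²(Ω) be positive on Ω and satisfy −Δu = Q(x) u^{2*−1} + ε u^s in Ω. Then for every closed ball B̄_r(x₀) ⊂ Ω and every index i ∈ {1,…,N}: (1/2*) ∫_{B_r(x₀)} (∂Q/∂x_i) u^{2*} dx = ∫_{∂B_r(x₀)} [ (∂u/∂ν)(∂u/∂x_i) + ( (1/2*) Q u^{2*} − (1/2)|∇u|² + (ε/(s+1)) u^{s+1} ) ν_i ] dσ, where ν(x) = (x−x₀)/r is the outward unit normal and σ is the (N−1)-dimensional surface measure on the sphere ∂B_r(x₀). -/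
open MeasureTheory Metric Real Filter Topology Set

noncomputable section

/-- The Laplacian of `u : ℝ^N → ℝ`, as the sum of the second partial derivatives
in the coordinate directions. -/
def laplacian {N : ℕ} (u : EuclideanSpace ℝ (Fin N) → ℝ)
    (x : EuclideanSpace ℝ (Fin N)) : ℝ :=
  ∑ i : Fin N,
    fderiv ℝ (fun y => fderiv ℝ u y (EuclideanSpace.single i 1)) x (EuclideanSpace.single i 1)

/-- The surface integral of `f` over the sphere of center `x₀` and radius `r` in `ℝ^N`,
with respect to the `(N-1)`-dimensional surface measure: it is expressed by
parametrizing the sphere by the unit sphere via `θ ↦ x₀ + r • θ` and scaling the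
standard surface measure `volume.toSphere` of the unit sphere by `r ^ (N-1)`. -/
def sphereIntegral (N : ℕ) (x₀ : EuclideanSpace ℝ (Fin N)) (r : ℝ)
    (f : EuclideanSpace ℝ (Fin N) → EuclideanSpace ℝ (Fin N) → ℝ) : ℝ :=
  r ^ (N - 1) *
    ∫ θ : Metric.sphere (0 : EuclideanSpace ℝ (Fin N)) 1,
      f (x₀ + r • (θ : EuclideanSpace ℝ (Fin N))) (θ : EuclideanSpace ℝ (Fin N))
      ∂((volume : Measure (EuclideanSpace ℝ (Fin N))).toSphere)

section Polar

variable {E : Type*} [NormedAddCommGroup E] [NormedSpace ℝ E] [FiniteDimensional ℝ E]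
  [MeasurableSpace E] [BorelSpace E] (μ : Measure E) [μ.IsAddHaarMeasure]

theorem continuous_integral_sphere_smul {h : E → ℝ} (hh : Continuous h) :
    Continuous fun t : ℝ => ∫ θ : sphere (0 : E) 1, h (t • (θ : E)) ∂μ.toSphere := by
  have := continuous_parametric_integral_of_continuous (μ := μ.toSphere)
    (f := fun (t : ℝ) (θ : sphere (0 : E) 1) => h (t • (θ : E))) (by fun_prop) isCompact_univ
  simpa using this

variable [Nontrivial E]

/-- Integration in polar coordinates. -/
theorem integral_eq_integral_Ioi_toSphere {f : E → ℝ} (hf : Integrable f μ) :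
    ∫ x, f x ∂μ = ∫ t in Ioi (0 : ℝ), t ^ (Module.finrank ℝ E - 1) *
      ∫ θ : sphere (0 : E) 1, f (t • (θ : E)) ∂μ.toSphere := by
  set n := Module.finrank ℝ E - 1 with hn
  set g : sphere (0 : E) 1 × Ioi (0 : ℝ) → ℝ := fun p => f (p.2.1 • (p.1 : E)) with hg
  have hgf : ∀ x : ({(0 : E)}ᶜ : Set E), g (homeomorphUnitSphereProd E x) = f x := by
    intro x
    have hx : ‖(x : E)‖ ≠ 0 := norm_ne_zero_iff.2 x.2
    simp [hg, smul_smul, hx]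
  have hmp := μ.measurePreserving_homeomorphUnitSphereProd
  have hemb := (homeomorphUnitSphereProd E).measurableEmbedding
  have hint : Integrable g (μ.toSphere.prod (Measure.volumeIoiPow n)) := by
    rw [← hmp.integrable_comp_emb hemb]
    have h1 : IntegrableOn f ({(0 : E)}ᶜ) μ := hf.integrableOn
    rw [integrableOn_iff_comap_subtypeVal (measurableSet_singleton _).compl] at h1
    refine h1.congr (.of_forall fun x => ?_)
    simp [hgf]
  calc
    ∫ x, f x ∂μ = ∫ x : ({(0)}ᶜ : Set E), f x ∂(μ.comap (↑)) := by
      rw [integral_subtype_comap (measurableSet_singleton _).compl f, restrict_compl_singleton]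
    _ = ∫ p, g p ∂μ.toSphere.prod (Measure.volumeIoiPow n) := by
      rw [← hmp.integral_comp hemb]
      simp [hgf]
    _ = ∫ t : Ioi (0 : ℝ), ∫ θ : sphere (0 : E) 1, f (t.1 • (θ : E)) ∂μ.toSphere
          ∂Measure.volumeIoiPow n := integral_prod_symm _ hint
    _ = _ := by
      simp only [Measure.volumeIoiPow, ENNReal.ofReal]
      rw [integral_withDensity_eq_integral_smul,
        integral_subtype_comap measurableSet_Ioi fun a : ℝ ↦ Real.toNNReal (a ^ n) •
          ∫ θ : sphere (0 : E) 1, f (a • (θ : E)) ∂μ.toSphere,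
        setIntegral_congr_fun measurableSet_Ioi fun x hx ↦ ?_]
      · rw [NNReal.smul_def, Real.coe_toNNReal _ (pow_nonneg hx.out.le _), smul_eq_mul]
      · exact (measurable_subtype_coe.pow_const _).real_toNNReal

/-- Integration over a ball in polar coordinates, with a radial weight. -/
theorem setIntegral_ball_radial_mul {w : ℝ → ℝ} (hw : Continuous w) {h : E → ℝ}
    (hh : Continuous h) {r : ℝ} (hr : 0 ≤ r) :
    ∫ x in ball (0 : E) r, w ‖x‖ * h x ∂μ = ∫ t in (0 : ℝ)..r, w t *
      (t ^ (Module.finrank ℝ E - 1) * ∫ θ : sphere (0 : E) 1, h (t • (θ : E)) ∂μ.toSphere) := by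
  have hint : IntegrableOn (fun x : E => w ‖x‖ * h x) (ball 0 r) μ :=
    ((Continuous.continuousOn (by fun_prop)).integrableOn_compact
      (isCompact_closedBall 0 r)).mono_set ball_subset_closedBall
  rw [← integral_indicator measurableSet_ball, integral_eq_integral_Ioi_toSphere μ
    (hint.integrable_indicator measurableSet_ball), intervalIntegral.integral_of_le hr,
    integral_Ioc_eq_integral_Ioo, ← integral_indicator measurableSet_Ioo,
    ← integral_indicator measurableSet_Ioi]
  congr 1 with t
  by_cases ht : 0 < t
  · have hnorm : ∀ θ : sphere (0 : E) 1, ‖t • (θ : E)‖ = t := fun θ => by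
      simp [norm_smul, abs_of_pos ht]
    by_cases htr : t < r
    · simp only [indicator, mem_Ioi, ht, mem_Ioo, htr, mem_ball_zero_iff, hnorm, if_true, and_self,
        integral_const_mul]
      ring
    · simp [indicator, ht, htr, hnorm]
  · simp [indicator, ht]

end Polar

section Divergence

variable {E : Type*} [NormedAddCommGroup E] [InnerProductSpace ℝ E] [FiniteDimensional ℝ E]
  [MeasurableSpace E] [BorelSpace E] (μ : Measure E) [μ.IsAddHaarMeasure]

theorem hasDerivAt_max_zero_sq (a : ℝ) :
    HasDerivAt (fun t : ℝ => max t 0 ^ 2) (2 * max a 0) a := by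
  rcases lt_trichotomy a 0 with ha | rfl | ha
  · have : (fun t : ℝ => max t 0 ^ 2) =ᶠ[𝓝 a] fun _ => 0 := by
      filter_upwards [Iio_mem_nhds ha] with t ht
      simp [max_eq_right (le_of_lt (show t < 0 from ht))]
    simpa [max_eq_right ha.le] using (hasDerivAt_const a (0 : ℝ)).congr_of_eventuallyEq this
  · rw [hasDerivAt_iff_isLittleO]
    simp only [max_self, sub_zero, mul_zero, smul_zero, ne_eq, OfNat.ofNat_ne_zero,
      not_false_eq_true, zero_pow]
    refine Asymptotics.IsBigO.trans_isLittleO (g := fun t : ℝ => t ^ 2) ?_ ?_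
    · refine Asymptotics.IsBigO.of_bound 1 (.of_forall fun t => ?_)
      rcases le_total t 0 with h | h <;> simp [h, sq_nonneg]
    · exact Asymptotics.isLittleO_pow_id one_lt_two
  · have : (fun t : ℝ => max t 0 ^ 2) =ᶠ[𝓝 a] fun t => t ^ 2 := by
      filter_upwards [Ioi_mem_nhds ha] with t ht
      simp [max_eq_left (le_of_lt (show 0 < t from ht))]
    simpa [max_eq_left ha.le] using ((hasDerivAt_id a).pow 2).congr_of_eventuallyEq this

/-- Integration by parts on a ball against the weight `(r ^ 2 - ‖x‖ ^ 2) ^ 2`. -/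
theorem setIntegral_ball_weight_mul_fderiv {f : E → ℝ} (hf : ContDiff ℝ 1 f) (v : E) {r : ℝ}
    (hr : 0 < r) :
    ∫ x in ball (0 : E) r, (r ^ 2 - ‖x‖ ^ 2) ^ 2 * fderiv ℝ f x v ∂μ =
      ∫ x in ball (0 : E) r, 4 * (r ^ 2 - ‖x‖ ^ 2) * (f x * inner ℝ x v) ∂μ := by
  set p : E → ℝ := fun x => max (r ^ 2 - ‖x‖ ^ 2) 0 with hp
  have hpc : Continuous p := by fun_prop
  have hf' : Continuous fun x => fderiv ℝ f x v := (hf.continuous_fderiv one_ne_zero).clm_apply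
    continuous_const
  have hfc : Continuous f := hf.continuous
  have hp0 : ∀ x ∉ ball (0 : E) r, p x = 0 := fun x hx => by
    have : r ≤ ‖x‖ := by simpa using hx
    exact max_eq_right (by nlinarith)
  have hp1 : ∀ x ∈ ball (0 : E) r, p x = r ^ 2 - ‖x‖ ^ 2 := fun x hx => by
    have : ‖x‖ < r := by simpa using hx
    exact max_eq_left (by nlinarith [norm_nonneg x])
  set w' : E → ℝ := fun x => p x ^ 2 * fderiv ℝ f x v - 4 * p x * (f x * inner ℝ x v) with hw'
  have hcs : ∀ g : E → ℝ, Continuous g → (∀ x ∉ ball (0 : E) r, g x = 0) → Integrable g μ :=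
    fun g hg h0 => hg.integrable_of_hasCompactSupport <|
      HasCompactSupport.intro (isCompact_closedBall 0 r) fun x hx =>
        h0 x fun h => hx (ball_subset_closedBall h)
  have hderiv : ∀ x, HasLineDerivAt ℝ (fun x => p x ^ 2 * f x) (w' x) x v := fun x => by
    have h1 : HasFDerivAt (fun x : E => r ^ 2 - ‖x‖ ^ 2) (-(2 • innerSL ℝ x)) x :=
      ((hasStrictFDerivAt_norm_sq x).hasFDerivAt).const_sub (r ^ 2)
    have h2 := (hasDerivAt_max_zero_sq (r ^ 2 - ‖x‖ ^ 2)).comp_hasFDerivAt x h1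
    have h3 := (h2.mul (hf.differentiable one_ne_zero x).hasFDerivAt).hasLineDerivAt v
    convert h3 using 1
    · rfl
    · simp [hw', hp]
      ring
  have hw'i : Integrable w' μ := hcs w' (by fun_prop) fun x hx => by simp [hw', hp0 x hx]
  have key : ∫ x, w' x ∂μ = 0 := by
    have := integral_bilinear_hasLineDerivAt_right_eq_neg_left_of_integrable (μ := μ)
      (f := fun _ : E => (1 : ℝ)) (f' := fun _ => 0) (g := fun x => p x ^ 2 * f x) (g' := w')
      (v := v) (B := ContinuousLinearMap.mul ℝ ℝ) (by simp) (by simpa using hw'i)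
      (by simpa using hcs _ (by fun_prop) fun x hx => by simp [hp0 x hx])
      (fun x _ => by simpa using (hasFDerivAt_const (1 : ℝ) x).hasLineDerivAt v)
      (fun x _ => hderiv x)
    simpa using this
  rw [← setIntegral_eq_integral_of_forall_compl_eq_zero
    (s := ball (0 : E) r) (fun x hx => by simp [hw', hp0 x hx])] at key
  rw [← sub_eq_zero, ← integral_sub, ← key]
  · exact setIntegral_congr_fun measurableSet_ball fun x hx => by simp [hw', hp1 x hx]
  all_goals
    exact ((Continuous.continuousOn (by fun_prop)).integrableOn_compact
      (isCompact_closedBall 0 r)).mono_set ball_subset_closedBall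

variable [Nontrivial E]

/-- The divergence theorem on a ball centered at the origin, for the vector field `f • v` with
`f` of class `C¹` on the whole space and `v` constant. -/
theorem setIntegral_ball_zero_fderiv {f : E → ℝ} (hf : ContDiff ℝ 1 f) (v : E) {r : ℝ}
    (hr : 0 < r) :
    ∫ x in ball (0 : E) r, fderiv ℝ f x v ∂μ = r ^ (Module.finrank ℝ E - 1) *
      ∫ θ : sphere (0 : E) 1, f (r • (θ : E)) * inner ℝ (θ : E) v ∂μ.toSphere := by
  have hf' : Continuous fun x => fderiv ℝ f x v := (hf.continuous_fderiv one_ne_zero).clm_apply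
    continuous_const
  have hfc : Continuous f := hf.continuous
  set n := Module.finrank ℝ E - 1 with hn
  set G : ℝ → ℝ := fun t => t ^ n * ∫ θ : sphere (0 : E) 1, fderiv ℝ f (t • (θ : E)) v ∂μ.toSphere
    with hG
  set g : ℝ → ℝ := fun t => t ^ n *
    ∫ θ : sphere (0 : E) 1, f (t • (θ : E)) * inner ℝ (t • (θ : E)) v ∂μ.toSphere with hg
  have hGc : Continuous G := by
    have := continuous_integral_sphere_smul μ hf'
    fun_prop
  have hgc : Continuous g := by
    have := continuous_integral_sphere_smul μ (h := fun x => f x * inner ℝ x v) (by fun_prop)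
    fun_prop
  have hD : ∀ φ : ℝ → ℝ, Continuous φ → ∀ t, HasDerivAt (fun s => ∫ x in (0:ℝ)..s, φ x) (φ t) t :=
    fun φ hφ t => (hφ.integral_hasStrictDerivAt 0 t).hasDerivAt
  have key : ∀ t > 0, t ^ 4 * (∫ x in (0:ℝ)..t, G x) - 2 * t ^ 2 * (∫ x in (0:ℝ)..t, x ^ 2 * G x)
      + (∫ x in (0:ℝ)..t, x ^ 4 * G x) =
      4 * t ^ 2 * (∫ x in (0:ℝ)..t, g x) - 4 * (∫ x in (0:ℝ)..t, x ^ 2 * g x) := fun t ht => by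
    have h0 := setIntegral_ball_weight_mul_fderiv μ hf v ht
    rw [setIntegral_ball_radial_mul μ (w := fun s => (t ^ 2 - s ^ 2) ^ 2) (by fun_prop) hf' ht.le,
      setIntegral_ball_radial_mul μ (w := fun s => 4 * (t ^ 2 - s ^ 2))
        (h := fun x => f x * inner ℝ x v) (by fun_prop) (by fun_prop) ht.le] at h0
    have hi : ∀ φ : ℝ → ℝ, Continuous φ → IntervalIntegrable φ volume 0 t :=
      fun φ hφ => hφ.intervalIntegrable _ _
    simp only [← intervalIntegral.integral_const_mul]
    rw [← intervalIntegral.integral_sub (hi _ (by fun_prop)) (hi _ (by fun_prop)),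
      ← intervalIntegral.integral_add (hi _ (by fun_prop)) (hi _ (by fun_prop)),
      ← intervalIntegral.integral_sub (hi _ (by fun_prop)) (hi _ (by fun_prop))]
    convert h0 using 2
    all_goals
      ext x
      simp only [hG, hg]
      ring
  have key1 : ∀ t > 0, t ^ 2 * (∫ x in (0:ℝ)..t, G x) - (∫ x in (0:ℝ)..t, x ^ 2 * G x)
      = 2 * (∫ x in (0:ℝ)..t, g x) := fun t ht => by
    have hl := ((((hasDerivAt_id t).pow 4).mul (hD G hGc t)).sub
      ((((hasDerivAt_id t).pow 2).const_mul 2).mul (hD (fun x => x ^ 2 * G x) (by fun_prop) t))).add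
      (hD (fun x => x ^ 4 * G x) (by fun_prop) t)
    have hr := ((((hasDerivAt_id t).pow 2).const_mul 4).mul (hD g hgc t)).sub
      ((hD (fun x => x ^ 2 * g x) (by fun_prop) t).const_mul 4)
    have := hl.unique (hr.congr_of_eventuallyEq
      (by filter_upwards [Ioi_mem_nhds ht] with s hs using key s hs))
    simp at this
    have h4 : (4 * t) * (t ^ 2 * (∫ x in (0:ℝ)..t, G x) - (∫ x in (0:ℝ)..t, x ^ 2 * G x)) =
      (4 * t) * (2 * (∫ x in (0:ℝ)..t, g x)) := by linear_combination this
    exact mul_left_cancel₀ (by positivity) h4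
  have key2 : r * (∫ x in (0:ℝ)..r, G x) = g r := by
    have hl := (((hasDerivAt_id r).pow 2).mul (hD G hGc r)).sub
      (hD (fun x => x ^ 2 * G x) (by fun_prop) r)
    have := hl.unique (((hD g hgc r).const_mul 2).congr_of_eventuallyEq
      (by filter_upwards [Ioi_mem_nhds hr] with s hs using key1 s hs))
    simp at this
    linear_combination this / 2
  have h1 := setIntegral_ball_radial_mul μ (w := fun _ => 1) (by fun_prop) hf' hr.le
  simp only [one_mul] at h1
  rw [h1]
  refine mul_left_cancel₀ hr.ne' (key2.trans ?_)
  simp only [hg, real_inner_smul_left, mul_left_comm _ r, integral_const_mul]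

/-- The divergence theorem on a ball, for the vector field `f • v` with `v` constant. -/
theorem setIntegral_ball_fderiv {Ω : Set E} (hΩ : IsOpen Ω) {f : E → ℝ}
    (hf : ContDiffOn ℝ 1 f Ω) (v x₀ : E) {r : ℝ} (hr : 0 < r) (hball : closedBall x₀ r ⊆ Ω) :
    ∫ x in ball x₀ r, fderiv ℝ f x v ∂μ = r ^ (Module.finrank ℝ E - 1) *
      ∫ θ : sphere (0 : E) 1, f (x₀ + r • (θ : E)) * inner ℝ (θ : E) v ∂μ.toSphere := by
  obtain ⟨δ, hδ, hδΩ⟩ := (isCompact_closedBall x₀ r).exists_cthickening_subset_open hΩ hball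
  rw [cthickening_closedBall hδ.le hr.le] at hδΩ
  let b : ContDiffBump x₀ := ⟨r + δ / 2, r + δ, by positivity, by linarith⟩
  set F : E → ℝ := fun x => b x * f x with hF
  have hFf : ∀ x ∈ closedBall x₀ r, F =ᶠ[𝓝 x] f := fun x hx => by
    have hx' : x ∈ ball x₀ b.rIn := closedBall_subset_ball (by simp [b, hδ]) hx
    filter_upwards [isOpen_ball.mem_nhds hx'] with y hy
    simp [hF, b.one_of_mem_closedBall (ball_subset_closedBall hy)]
  have hFc : ContDiff ℝ 1 F := contDiff_iff_contDiffAt.2 fun x => by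
    by_cases hx : x ∈ Ω
    · exact b.contDiff.contDiffAt.mul (hf.contDiffAt (hΩ.mem_nhds hx))
    · have hx' : x ∈ (closedBall x₀ (δ + r))ᶜ := fun h => hx (hδΩ (by rwa [add_comm] at *))
      refine (contDiffAt_const (c := (0 : ℝ))).congr_of_eventuallyEq ?_
      filter_upwards [isClosed_closedBall.isOpen_compl.mem_nhds hx'] with y hy
      have : b y = 0 := b.zero_of_le_dist (by
        have : δ + r < dist y x₀ := by simpa using hy
        simp only [b]; linarith)
      simp [hF, this]
  have h := setIntegral_ball_zero_fderiv μ (f := fun x => F (x₀ + x))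
    (hFc.comp (contDiff_const.add contDiff_id)) v hr
  simp only [fderiv_comp_add_left] at h
  have htr : ∫ x in ball (0 : E) r, fderiv ℝ F (x₀ + x) v ∂μ =
      ∫ x in ball x₀ r, fderiv ℝ F x v ∂μ := by
    have := (measurePreserving_add_left μ x₀).setIntegral_preimage_emb
      (measurableEmbedding_addLeft x₀) (fun x => fderiv ℝ F x v) (ball x₀ r)
    rw [← this]
    simp
  rw [htr] at h
  calc
    _ = ∫ x in ball x₀ r, fderiv ℝ F x v ∂μ := by
      refine setIntegral_congr_fun measurableSet_ball fun x hx => ?_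
      simp only [(hFf x (ball_subset_closedBall hx)).fderiv_eq]
    _ = _ := by
      rw [h]
      congr 2 with θ
      rw [(hFf (x₀ + r • (θ : E)) (by simp [norm_smul, abs_of_pos hr])).self_of_nhds]

end Divergence

/-- The translation-type Pohozaev vector field associated with the direction `i` has its
divergence given by the equation. -/
theorem sum_fderiv_pohozaev {N : ℕ} {Ω : Set (EuclideanSpace ℝ (Fin N))} (hΩ : IsOpen Ω)
    {Q u : EuclideanSpace ℝ (Fin N) → ℝ} (hQ : ContDiffOn ℝ 1 Q Ω) {ε s p : ℝ} (hp : p ≠ 0)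
    (hs : s + 1 ≠ 0) (hu : ContDiffOn ℝ 2 u Ω) (hupos : ∀ x ∈ Ω, 0 < u x)
    {x : EuclideanSpace ℝ (Fin N)} (hx : x ∈ Ω)
    (hpde : -laplacian u x = Q x * u x ^ (p - 1) + ε * u x ^ s) (i : Fin N) :
    ∑ j, fderiv ℝ (fun y => fderiv ℝ u y (EuclideanSpace.single j 1) *
        fderiv ℝ u y (EuclideanSpace.single i 1)) x (EuclideanSpace.single j 1) +
      fderiv ℝ (fun y => (1 / p) * Q y * u y ^ p -
        (1 / 2) * ∑ j, fderiv ℝ u y (EuclideanSpace.single j 1) ^ 2 +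
        (ε / (s + 1)) * u y ^ (s + 1)) x (EuclideanSpace.single i 1) =
      (1 / p) * (fderiv ℝ Q x (EuclideanSpace.single i 1) * u x ^ p) := by
  have hux : ContDiffAt ℝ 2 u x := hu.contDiffAt (hΩ.mem_nhds hx)
  have hd : HasFDerivAt u (fderiv ℝ u x) x := (hux.differentiableAt two_ne_zero).hasFDerivAt
  have hQd : HasFDerivAt Q (fderiv ℝ Q x) x :=
    ((hQ.contDiffAt (hΩ.mem_nhds hx)).differentiableAt one_ne_zero).hasFDerivAt
  have hdd : DifferentiableAt ℝ (fderiv ℝ u) x :=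
    (hux.fderiv_right (m := 1) (by norm_num)).differentiableAt one_ne_zero
  have hpos := hupos x hx
  set e : Fin N → EuclideanSpace ℝ (Fin N) := fun j => EuclideanSpace.single j 1 with he
  set L := fderiv ℝ (fderiv ℝ u) x with hL
  have hD : ∀ v, HasFDerivAt (fun y => fderiv ℝ u y v) (L.flip v) x := fun v => by
    have := hdd.hasFDerivAt.clm_apply (hasFDerivAt_const v x)
    simpa using this
  have hsymm : ∀ v w, L v w = L w v := fun v w =>
    (hux.isSymmSndFDerivAt (by simp)).eq v w
  have hlap : laplacian u x = ∑ j, L (e j) (e j) := by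
    simp only [laplacian]
    exact Finset.sum_congr rfl fun j _ => by rw [(hD _).fderiv]; rfl
  have h1 : ∀ j, fderiv ℝ (fun y => fderiv ℝ u y (e j) * fderiv ℝ u y (e i)) x (e j) =
      fderiv ℝ u x (e j) * L (e i) (e j) + fderiv ℝ u x (e i) * L (e j) (e j) := fun j => by
    rw [((hD (e j)).fun_mul (hD (e i))).fderiv]
    simp [hsymm (e i) (e j)]
  have h2 : HasFDerivAt (fun y => (1 / p) * Q y * u y ^ p -
        (1 / 2) * ∑ j, fderiv ℝ u y (e j) ^ 2 + (ε / (s + 1)) * u y ^ (s + 1)) _ x :=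
    (((hQd.const_mul (1 / p)).mul (hd.rpow_const (p := p) (.inl hpos.ne'))).sub
      ((HasFDerivAt.fun_sum (u := Finset.univ) fun j _ => (hD (e j)).pow 2).const_mul (1 / 2))).add
      ((hd.rpow_const (p := s + 1) (.inl hpos.ne')).const_mul (ε / (s + 1)))
  change ∑ j, fderiv ℝ (fun y => fderiv ℝ u y (e j) * fderiv ℝ u y (e i)) x (e j) + _ = _
  rw [h2.fderiv]
  simp only [h1, Finset.sum_add_distrib, ← Finset.mul_sum, ← hlap]
  simp [mul_assoc, ← Finset.mul_sum]
  have hl : laplacian u x = -(Q x * u x ^ (p - 1) + ε * u x ^ s) := by linarith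
  rw [hl]
  field_simp
  ring

theorem fderiv_apply_eq_sum {N : ℕ} (u : EuclideanSpace ℝ (Fin N) → ℝ)
    (x v : EuclideanSpace ℝ (Fin N)) :
    fderiv ℝ u x v = ∑ j, v j * fderiv ℝ u x (EuclideanSpace.single j 1) := by
  conv_lhs => rw [← (EuclideanSpace.basisFun (Fin N) ℝ).sum_repr v]
  simp

theorem norm_gradient_sq {N : ℕ} (u : EuclideanSpace ℝ (Fin N) → ℝ)
    (x : EuclideanSpace ℝ (Fin N)) :
    ‖gradient u x‖ ^ 2 = ∑ j, fderiv ℝ u x (EuclideanSpace.single j 1) ^ 2 := by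
  rw [EuclideanSpace.real_norm_sq_eq]
  refine Finset.sum_congr rfl fun j _ => ?_
  have h : inner ℝ (gradient u x) (EuclideanSpace.single j 1) =
      fderiv ℝ u x (EuclideanSpace.single j 1) := by simp [gradient]
  rw [← h, EuclideanSpace.inner_single_right]
  simp

/-- **Translation-type local Pohozaev identity.**
If `u ∈ C²(Ω)` is positive and solves `-Δu = Q(x) u^{2*-1} + ε u^s` in an open set `Ω ⊆ ℝ^N`
(`N ≥ 3`, `2* = 2N/(N-2)`, `Q ∈ C¹(Ω)`, `ε ≥ 0`, `s ≥ 1`), then for every closed ball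
`closedBall x₀ r ⊆ Ω` (with `r > 0`) and every coordinate `i`,
`(1/2*) ∫_{B_r(x₀)} ∂_i Q · u^{2*}
  = ∫_{∂B_r(x₀)} [ ∂_ν u ∂_i u + ( (1/2*) Q u^{2*} - |∇u|²/2 + ε u^{s+1}/(s+1) ) ν_i ] dσ`,
where `ν(x) = (x - x₀)/r` is the outward unit normal (i.e. `ν = θ` in the parametrization
of the sphere by the unit sphere). -/
theorem translation_pohozaev
    (N : ℕ) (hN : 3 ≤ N)
    (Ω : Set (EuclideanSpace ℝ (Fin N))) (hΩ : IsOpen Ω)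
    (Q u : EuclideanSpace ℝ (Fin N) → ℝ)
    (hQ : ContDiffOn ℝ 1 Q Ω)
    (ε s : ℝ) (hε : 0 ≤ ε) (hs : 1 ≤ s)
    (hu : ContDiffOn ℝ 2 u Ω)
    (hupos : ∀ x ∈ Ω, 0 < u x)
    (hpde : ∀ x ∈ Ω,
      -laplacian u x = Q x * u x ^ ((2 * N : ℝ) / ((N : ℝ) - 2) - 1) + ε * u x ^ s)
    (x₀ : EuclideanSpace ℝ (Fin N)) (r : ℝ) (hr : 0 < r)
    (hball : Metric.closedBall x₀ r ⊆ Ω) (i : Fin N) :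
    (1 / ((2 * N : ℝ) / ((N : ℝ) - 2))) *
        ∫ x in Metric.ball x₀ r,
          (fderiv ℝ Q x (EuclideanSpace.single i 1)) * u x ^ ((2 * N : ℝ) / ((N : ℝ) - 2))
      = sphereIntegral N x₀ r (fun x ν =>
          (fderiv ℝ u x ν) * (fderiv ℝ u x (EuclideanSpace.single i 1))
          + ((1 / ((2 * N : ℝ) / ((N : ℝ) - 2))) * Q x * u x ^ ((2 * N : ℝ) / ((N : ℝ) - 2))
              - (1 / 2) * ‖gradient u x‖ ^ 2
              + (ε / (s + 1)) * u x ^ (s + 1)) * ν i) := by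
  set p : ℝ := (2 * N : ℝ) / ((N : ℝ) - 2) with hp
  have hN' : (3 : ℝ) ≤ N := by exact_mod_cast hN
  have hp0 : p ≠ 0 := (div_pos (by linarith) (by linarith)).ne'
  have : Nonempty (Fin N) := ⟨i⟩
  set V : Fin N → EuclideanSpace ℝ (Fin N) → ℝ := fun j y =>
    fderiv ℝ u y (EuclideanSpace.single j 1) * fderiv ℝ u y (EuclideanSpace.single i 1) with hV
  set P : EuclideanSpace ℝ (Fin N) → ℝ := fun y => (1 / p) * Q y * u y ^ p -
    (1 / 2) * ∑ j, fderiv ℝ u y (EuclideanSpace.single j 1) ^ 2 +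
    (ε / (s + 1)) * u y ^ (s + 1) with hP
  have hDu : ∀ v, ContDiffOn ℝ 1 (fun y => fderiv ℝ u y v) Ω := fun v =>
    (hu.fderiv_of_isOpen hΩ (m := 1) (by norm_num)).clm_apply contDiffOn_const
  have hu1 : ContDiffOn ℝ 1 u Ω := hu.of_le (by norm_num)
  have hVc : ∀ j, ContDiffOn ℝ 1 (V j) Ω := fun j => (hDu _).mul (hDu _)
  have hpow : ∀ q : ℝ, ContDiffOn ℝ 1 (fun y => u y ^ q) Ω := fun q =>
    hu1.rpow_const_of_ne fun x hx => (hupos x hx).ne'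
  have hPc : ContDiffOn ℝ 1 P Ω :=
    (((contDiffOn_const.mul hQ).mul (hpow p)).sub
      (contDiffOn_const.mul (ContDiffOn.sum fun j _ => (hDu _).pow 2))).add
      (contDiffOn_const.mul (hpow (s + 1)))
  have hint : ∀ f : EuclideanSpace ℝ (Fin N) → ℝ, ContDiffOn ℝ 1 f Ω →
      ∀ v, IntegrableOn (fun x => fderiv ℝ f x v) (ball x₀ r) := fun f hf v =>
    ((((hf.continuousOn_fderiv_of_isOpen hΩ le_rfl).clm_apply continuousOn_const).mono
      hball).integrableOn_compact (isCompact_closedBall x₀ r)).mono_set ball_subset_closedBall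
  have hints : ∀ f : EuclideanSpace ℝ (Fin N) → ℝ, ContDiffOn ℝ 1 f Ω → ∀ v, Integrable
      (fun θ : sphere (0 : EuclideanSpace ℝ (Fin N)) 1 =>
        f (x₀ + r • (θ : EuclideanSpace ℝ (Fin N))) *
          inner ℝ (θ : EuclideanSpace ℝ (Fin N)) v) volume.toSphere := fun f hf v => by
    have hc : Continuous fun θ : sphere (0 : EuclideanSpace ℝ (Fin N)) 1 =>
        f (x₀ + r • (θ : EuclideanSpace ℝ (Fin N))) :=
      hf.continuousOn.comp_continuous (by fun_prop) fun θ =>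
        hball (by simp [norm_smul, abs_of_pos hr])
    exact (hc.mul (by fun_prop)).integrable_of_hasCompactSupport
      (HasCompactSupport.of_compactSpace _)
  have hdiv := fun f (hf : ContDiffOn ℝ 1 f Ω) v => setIntegral_ball_fderiv
    (volume : Measure (EuclideanSpace ℝ (Fin N))) hΩ (f := f) hf v x₀ hr hball
  simp only [finrank_euclideanSpace, Fintype.card_fin] at hdiv
  rw [← integral_const_mul]
  calc
    _ = ∫ x in ball x₀ r, (∑ j, fderiv ℝ (V j) x (EuclideanSpace.single j 1) +
          fderiv ℝ P x (EuclideanSpace.single i 1)) :=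
      setIntegral_congr_fun measurableSet_ball fun x hx =>
        have hxΩ := hball (ball_subset_closedBall hx)
        (sum_fderiv_pohozaev hΩ hQ hp0 (by linarith) hu hupos hxΩ (hpde x hxΩ) i).symm
    _ = r ^ (N - 1) * ∫ θ : sphere (0 : EuclideanSpace ℝ (Fin N)) 1,
          (∑ j, V j (x₀ + r • (θ : EuclideanSpace ℝ (Fin N))) *
            inner ℝ (θ : EuclideanSpace ℝ (Fin N)) (EuclideanSpace.single j 1) +
          P (x₀ + r • (θ : EuclideanSpace ℝ (Fin N))) *
            inner ℝ (θ : EuclideanSpace ℝ (Fin N)) (EuclideanSpace.single i 1))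
          ∂(volume : Measure (EuclideanSpace ℝ (Fin N))).toSphere := by
      rw [integral_add (integrable_finsetSum _ fun j _ => hint _ (hVc j) _) (hint _ hPc _),
        integral_add (integrable_finsetSum _ fun j _ => hints _ (hVc j) _) (hints _ hPc _),
        integral_finsetSum _ fun j _ => hint _ (hVc j) _,
        integral_finsetSum _ fun j _ => hints _ (hVc j) _, mul_add, Finset.mul_sum, hdiv P hPc]
      simp only [hdiv _ (hVc _)]
    _ = _ := by
      rw [sphereIntegral]
      congr 2 with θ
      rw [norm_gradient_sq, fderiv_apply_eq_sum]
      simp only [hV, hP, EuclideanSpace.inner_single_right, Finset.sum_mul]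
      simp [mul_comm, mul_left_comm]

end
end

section
/- Let N ≥ 3, 2* = 2N/(N−2), let a ∈ ℝ^N, d > 0, and let Q be a C² real-valued function on the ball B_{2d}(a). Then for any sequences x_n → a in ℝ^N and λ_n → +∞, λ_n² ∫_{B_d(x_n)} ((y − x_n)·∇Q(y)) U_{x_n,λ_n}(y)^{2*} dy → (N(N−2))^{N/2} · (ΔQ(a)/N) · ∫_{ℝ^N} |z|² (1+|z|²)^{−N} dz as n → ∞. -/
open MeasureTheory Metric Real Filter Topology Set

noncomputable section

/-- The critical Sobolev exponent `2* = 2N/(N-2)`. -/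
def twoStar (N : ℕ) : ℝ := 2 * N / ((N : ℝ) - 2)

/-- The Aubin–Talenti bubble
`U_{x,λ}(y) = (N(N-2))^{(N-2)/4} λ^{(N-2)/2} (1 + λ²|y-x|²)^{-(N-2)/2}`. -/
def bubble (N : ℕ) (x : EuclideanSpace ℝ (Fin N)) (lam : ℝ)
    (y : EuclideanSpace ℝ (Fin N)) : ℝ :=
  ((N : ℝ) * ((N : ℝ) - 2)) ^ (((N : ℝ) - 2) / 4) * lam ^ (((N : ℝ) - 2) / 2) /
    (1 + lam ^ 2 * ‖y - x‖ ^ 2) ^ (((N : ℝ) - 2) / 2)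


section Radial

variable {N : ℕ}

/-- Linear isometric equivalences of Euclidean space preserve Lebesgue integrals. -/
lemma integral_comp_linearIsometryEquiv
    (T : EuclideanSpace ℝ (Fin N) ≃ₗᵢ[ℝ] EuclideanSpace ℝ (Fin N))
    (f : EuclideanSpace ℝ (Fin N) → ℝ) : ∫ z, f (T z) = ∫ z, f z :=
  T.measurePreserving.integral_comp T.toHomeomorph.measurableEmbedding f

lemma integrable_coord_mul_coord {w : EuclideanSpace ℝ (Fin N) → ℝ}
    (hw : Integrable fun z => ‖z‖ ^ 2 * w z) (i j : Fin N) :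
    Integrable fun z => z i * z j * w z := by
  have h := hw.bdd_mul (f := fun z : EuclideanSpace ℝ (Fin N) => z i * z j / ‖z‖ ^ 2) (c := 1)
    (by
      apply Measurable.aestronglyMeasurable
      fun_prop)
    (ae_of_all _ fun z => by
      rw [norm_div, norm_mul, norm_pow, norm_norm, sq]
      exact div_le_one_of_le₀
        (mul_le_mul (PiLp.norm_apply_le z i) (PiLp.norm_apply_le z j)
          (norm_nonneg _) (norm_nonneg _)) (by positivity))
  refine h.congr (ae_of_all _ fun z => ?_)
  rcases eq_or_ne z 0 with rfl | hz
  · simp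
  · have : ‖z‖ ≠ 0 := norm_ne_zero_iff.2 hz
    field_simp

lemma integral_coord_mul_coord_of_ne {w : EuclideanSpace ℝ (Fin N) → ℝ}
    (hrad : ∀ (T : EuclideanSpace ℝ (Fin N) ≃ₗᵢ[ℝ] EuclideanSpace ℝ (Fin N)) z, w (T z) = w z)
    {i j : Fin N} (hij : i ≠ j) :
    ∫ z : EuclideanSpace ℝ (Fin N), z i * z j * w z = 0 := by
  let T : EuclideanSpace ℝ (Fin N) ≃ₗᵢ[ℝ] EuclideanSpace ℝ (Fin N) :=
    LinearIsometryEquiv.piLpCongrRight 2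
      fun k => if k = i then LinearIsometryEquiv.neg ℝ else LinearIsometryEquiv.refl ℝ ℝ
  have hi : ∀ z, (T z) i = - z i := fun z => by simp [T]
  have hj : ∀ z, (T z) j = z j := fun z => by simp [T, hij.symm]
  have h := integral_comp_linearIsometryEquiv T fun z => z i * z j * w z
  simp only [hrad, hi, hj, neg_mul, integral_neg] at h
  linarith

lemma integral_coord_sq_eq {w : EuclideanSpace ℝ (Fin N) → ℝ}
    (hrad : ∀ (T : EuclideanSpace ℝ (Fin N) ≃ₗᵢ[ℝ] EuclideanSpace ℝ (Fin N)) z, w (T z) = w z)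
    (i j : Fin N) :
    ∫ z : EuclideanSpace ℝ (Fin N), z i * z i * w z =
      ∫ z : EuclideanSpace ℝ (Fin N), z j * z j * w z := by
  let T : EuclideanSpace ℝ (Fin N) ≃ₗᵢ[ℝ] EuclideanSpace ℝ (Fin N) :=
    LinearIsometryEquiv.piLpCongrLeft 2 ℝ ℝ (Equiv.swap i j)
  have hj : ∀ z, (T z) j = z i := fun z => by
    simp [T, LinearIsometryEquiv.piLpCongrLeft_apply, Equiv.piCongrLeft']
  have h := integral_comp_linearIsometryEquiv T fun z => z j * z j * w z
  simpa only [hrad, hj] using h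

lemma integral_coord_sq {w : EuclideanSpace ℝ (Fin N) → ℝ}
    (hrad : ∀ (T : EuclideanSpace ℝ (Fin N) ≃ₗᵢ[ℝ] EuclideanSpace ℝ (Fin N)) z, w (T z) = w z)
    (hw : Integrable fun z => ‖z‖ ^ 2 * w z) (i : Fin N) :
    ∫ z : EuclideanSpace ℝ (Fin N), z i * z i * w z = (∫ z, ‖z‖ ^ 2 * w z) / N := by
  have hN : (N : ℝ) ≠ 0 := by
    have := i.pos
    positivity
  have h : ∫ z, ‖z‖ ^ 2 * w z = ∑ j : Fin N, ∫ z : EuclideanSpace ℝ (Fin N), z j * z j * w z := by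
    rw [← integral_finsetSum _ fun j _ => integrable_coord_mul_coord hw j j]
    congr 1 with z
    rw [EuclideanSpace.real_norm_sq_eq, Finset.sum_mul]
    simp only [sq]
  rw [h, Finset.sum_congr rfl fun j _ => integral_coord_sq_eq hrad j i]
  simp [hN]

/-- The integral of a quadratic form against a radial weight only sees its trace. -/
lemma integral_bilin_mul_radial {w : EuclideanSpace ℝ (Fin N) → ℝ}
    (hrad : ∀ (T : EuclideanSpace ℝ (Fin N) ≃ₗᵢ[ℝ] EuclideanSpace ℝ (Fin N)) z, w (T z) = w z)
    (hw : Integrable fun z => ‖z‖ ^ 2 * w z)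
    (B : EuclideanSpace ℝ (Fin N) →L[ℝ] EuclideanSpace ℝ (Fin N) →L[ℝ] ℝ) :
    ∫ z, B z z * w z =
      (∑ i, B (EuclideanSpace.single i 1) (EuclideanSpace.single i 1)) / N *
        ∫ z, ‖z‖ ^ 2 * w z := by
  have hB : ∀ z, B z z * w z = ∑ i, ∑ j,
      B (EuclideanSpace.single i 1) (EuclideanSpace.single j 1) * (z i * z j * w z) := by
    intro z
    have hz : z = ∑ i, z i • EuclideanSpace.single i (1 : ℝ) := by
      ext k
      simp [Finset.sum_apply, Pi.single_apply]
    conv_lhs => rw [hz]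
    simp only [map_sum, map_smul, sum_apply, smul_apply,
      smul_eq_mul, Finset.sum_mul, Finset.mul_sum]
    rw [Finset.sum_comm]
    refine Finset.sum_congr rfl fun i _ => Finset.sum_congr rfl fun j _ => ?_
    rw [← hz]
    ring
  simp_rw [hB]
  rw [integral_finsetSum _ fun i _ => integrable_finsetSum _ fun j _ =>
    (integrable_coord_mul_coord hw i j).const_mul _]
  rw [Finset.sum_div, Finset.sum_mul]
  refine Finset.sum_congr rfl fun i _ => ?_
  rw [integral_finsetSum _ fun j _ => (integrable_coord_mul_coord hw i j).const_mul _]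
  rw [Finset.sum_eq_single i]
  · rw [integral_const_mul, integral_coord_sq hrad hw]
    ring
  · intro j _ hj
    rw [integral_const_mul, integral_coord_mul_coord_of_ne hrad hj.symm, mul_zero]
  · simp

lemma integrable_norm_sq_mul_rpow (hN : 3 ≤ N) :
    Integrable fun z : EuclideanSpace ℝ (Fin N) => ‖z‖ ^ 2 * (1 + ‖z‖ ^ 2) ^ (-(N : ℝ)) := by
  have hN' : (3 : ℝ) ≤ N := by exact_mod_cast hN
  have h := integrable_rpow_neg_one_add_norm_sq
    (μ := (volume : Measure (EuclideanSpace ℝ (Fin N)))) (r := 2 * (N : ℝ) - 2) (by simp; linarith)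
  refine h.mono' (Measurable.aestronglyMeasurable (by fun_prop)) (ae_of_all _ fun z => ?_)
  rw [Real.norm_of_nonneg (by positivity),
    show -(2 * (N : ℝ) - 2) / 2 = 1 + -(N : ℝ) by ring, rpow_add (by positivity), rpow_one]
  gcongr
  linarith [sq_nonneg ‖z‖]

lemma integrable_one_add_norm_sq_rpow (hN : 3 ≤ N) :
    Integrable fun z : EuclideanSpace ℝ (Fin N) => (1 + ‖z‖ ^ 2) ^ (-(N : ℝ)) := by
  have hN' : (3 : ℝ) ≤ N := by exact_mod_cast hN
  have h := integrable_rpow_neg_one_add_norm_sq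
    (μ := (volume : Measure (EuclideanSpace ℝ (Fin N)))) (r := 2 * (N : ℝ)) (by simp; linarith)
  simpa [neg_div] using h

end Radial

lemma bubble_rpow_twoStar {N : ℕ} (hN : 3 ≤ N) (x y : EuclideanSpace ℝ (Fin N)) {lam : ℝ}
    (hlam : 0 < lam) :
    bubble N x lam y ^ twoStar N =
      ((N : ℝ) * ((N : ℝ) - 2)) ^ ((N : ℝ) / 2) * lam ^ N *
        (1 + ‖lam • (y - x)‖ ^ 2) ^ (-(N : ℝ)) := by
  have hN' : (3 : ℝ) ≤ N := by exact_mod_cast hN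
  have h2 : (N : ℝ) - 2 ≠ 0 := by linarith
  have hc : 0 ≤ (N : ℝ) * ((N : ℝ) - 2) := mul_nonneg (by linarith) (by linarith)
  rw [bubble, twoStar, norm_smul, mul_pow, Real.norm_of_nonneg hlam.le,
    div_rpow (by positivity) (by positivity), mul_rpow (by positivity) (by positivity),
    ← rpow_mul hc, ← rpow_mul hlam.le, ← rpow_mul (by positivity), rpow_neg (by positivity),
    ← div_eq_mul_inv, ← rpow_natCast lam N]
  congr 3 <;> field_simp
  norm_num

lemma laplacian_eq_sum_fderiv_fderiv {N : ℕ} {Q : EuclideanSpace ℝ (Fin N) → ℝ}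
    {a : EuclideanSpace ℝ (Fin N)} (h : DifferentiableAt ℝ (fderiv ℝ Q) a) :
    laplacian Q a =
      ∑ i, fderiv ℝ (fderiv ℝ Q) a (EuclideanSpace.single i 1) (EuclideanSpace.single i 1) := by
  refine Finset.sum_congr rfl fun i _ => ?_
  rw [(h.hasFDerivAt.clm_apply (hasFDerivAt_const (EuclideanSpace.single i (1 : ℝ)) a)).fderiv]
  simp

/-- Difference quotients with moving base points converge to the strict derivative. -/
lemma HasStrictFDerivAt.tendsto_smul_sub {E F : Type*} [NormedAddCommGroup E] [NormedSpace ℝ E]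
    [NormedAddCommGroup F] [NormedSpace ℝ F] {f : E → F} {f' : E →L[ℝ] F} {a : E}
    (hf : HasStrictFDerivAt f f' a) {x : ℕ → E} (hx : Tendsto x atTop (𝓝 a))
    {lam : ℕ → ℝ} (hlam : Tendsto lam atTop atTop) (z : E) :
    Tendsto (fun n => lam n • (f (x n + (lam n)⁻¹ • z) - f (x n))) atTop (𝓝 (f' z)) := by
  have hp : Tendsto (fun n => (x n + (lam n)⁻¹ • z, x n)) atTop (𝓝 (a, a)) := by
    refine Tendsto.prodMk_nhds ?_ hx
    simpa using hx.add ((tendsto_inv_atTop_zero.comp hlam).smul_const z)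
  have h1 := (Asymptotics.isBigO_refl lam atTop).smul_isLittleO
    (hf.isLittleO.comp_tendsto hp)
  have hpos := hlam.eventually_gt_atTop 0
  have h2 : (fun n => lam n • (f (x n + (lam n)⁻¹ • z) - f (x n)) - f' z)
      =o[atTop] fun _ => z := by
    refine h1.congr' ?_ ?_
    · filter_upwards [hpos] with n hn
      simp [smul_sub, smul_smul, hn.ne']
    · filter_upwards [hpos] with n hn
      simp [smul_smul, hn.ne']
  have h3 : Tendsto (fun n => lam n • (f (x n + (lam n)⁻¹ • z) - f (x n)) - f' z)
      atTop (𝓝 0) := by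
    rcases eq_or_ne z 0 with rfl | hz
    · simp
    · exact (Asymptotics.isLittleO_const_iff hz).1 h2
  simpa using h3.add_const (f' z)

/-- Rescaling `y = x + z / lam` turns the weighted integral into one over a large ball. -/
lemma integral_ball_bubble {N : ℕ} (hN : 3 ≤ N) (Q : EuclideanSpace ℝ (Fin N) → ℝ)
    (x : EuclideanSpace ℝ (Fin N)) (d : ℝ) {lam : ℝ} (hlam : 0 < lam) :
    lam ^ 2 * ∫ y in Metric.ball x d, fderiv ℝ Q y (y - x) * bubble N x lam y ^ twoStar N =
      ((N : ℝ) * ((N : ℝ) - 2)) ^ ((N : ℝ) / 2) * ∫ z in Metric.ball 0 (lam * d),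
        lam * fderiv ℝ Q (x + lam⁻¹ • z) z * (1 + ‖z‖ ^ 2) ^ (-(N : ℝ)) := by
  rw [← integral_indicator measurableSet_ball, ← integral_indicator measurableSet_ball,
    ← integral_add_left_eq_self _ x]
  set g : EuclideanSpace ℝ (Fin N) → ℝ := fun y => (Metric.ball x d).indicator
    (fun y => fderiv ℝ Q y (y - x) * bubble N x lam y ^ twoStar N) (x + y) with hg
  have h := Measure.integral_comp_smul volume g lam⁻¹
  rw [finrank_euclideanSpace_fin, inv_pow, inv_inv, abs_of_pos (by positivity), smul_eq_mul] at h
  have h' : ∫ z, g z = (lam ^ N)⁻¹ * ∫ z, g (lam⁻¹ • z) := by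
    rw [h]
    field_simp
  rw [h', ← integral_const_mul, ← integral_const_mul, ← integral_const_mul]
  congr 1 with z
  have hmem : x + lam⁻¹ • z ∈ Metric.ball x d ↔ z ∈ Metric.ball 0 (lam * d) := by
    simp [norm_smul, abs_of_pos hlam, inv_mul_lt_iff₀ hlam]
  by_cases hz : z ∈ Metric.ball 0 (lam * d)
  · rw [hg]
    simp only [Set.indicator_of_mem hz, Set.indicator_of_mem (hmem.2 hz),
      bubble_rpow_twoStar hN _ _ hlam, add_sub_cancel_left, map_smul, smul_eq_mul,
      smul_inv_smul₀ hlam.ne']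
    field_simp
  · rw [hg]
    simp only [Set.indicator_of_notMem hz, Set.indicator_of_notMem (mt hmem.1 hz), mul_zero]

lemma integral_ball_odd_eq_zero {E : Type*} [NormedAddCommGroup E] [MeasurableSpace E]
    [BorelSpace E] {μ : Measure E} [μ.IsNegInvariant] {f : E → ℝ}
    (hf : ∀ z, f (-z) = -f z) (r : ℝ) : ∫ z in Metric.ball 0 r, f z ∂μ = 0 := by
  rw [← integral_indicator measurableSet_ball]
  have h := integral_neg_eq_self ((Metric.ball (0 : E) r).indicator f) μ
  have hneg : ∀ z, (Metric.ball (0 : E) r).indicator f (-z) =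
      -(Metric.ball (0 : E) r).indicator f z := by
    intro z
    by_cases hz : z ∈ Metric.ball (0 : E) r
    · have hz' : -z ∈ Metric.ball (0 : E) r := by simpa using hz
      simp only [Set.indicator_of_mem hz, Set.indicator_of_mem hz', hf]
    · have hz' : -z ∉ Metric.ball (0 : E) r := by simpa using hz
      simp only [Set.indicator_of_notMem hz, Set.indicator_of_notMem hz', neg_zero]
  simp only [hneg, integral_neg] at h
  linarith

/-- On the ball of radius `3d/2` the derivative of a `C²` function on the ball of radius `2d` is
Lipschitz. -/
lemma exists_norm_fderiv_sub_le {E : Type*} [NormedAddCommGroup E] [NormedSpace ℝ E]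
    [ProperSpace E] {Q : E → ℝ} {a : E} {d : ℝ} (hd : 0 < d)
    (hQ : ContDiffOn ℝ 2 Q (Metric.ball a (2 * d))) :
    ∃ M, 0 ≤ M ∧ ∀ y ∈ Metric.closedBall a (3 / 2 * d), ∀ y' ∈ Metric.closedBall a (3 / 2 * d),
      ‖fderiv ℝ Q y' - fderiv ℝ Q y‖ ≤ M * ‖y' - y‖ := by
  have hsub : Metric.closedBall a (3 / 2 * d) ⊆ Metric.ball a (2 * d) :=
    Metric.closedBall_subset_ball (by linarith)
  have h1 : ContDiffOn ℝ 1 (fderiv ℝ Q) (Metric.ball a (2 * d)) :=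
    hQ.fderiv_of_isOpen Metric.isOpen_ball (by norm_num)
  have h2 : ContinuousOn (fderiv ℝ (fderiv ℝ Q)) (Metric.ball a (2 * d)) :=
    h1.continuousOn_fderiv_of_isOpen Metric.isOpen_ball le_rfl
  obtain ⟨M, hM⟩ := (isCompact_closedBall a (3 / 2 * d)).exists_bound_of_continuousOn
    (f := fderiv ℝ (fderiv ℝ Q)) (h2.mono hsub)
  refine ⟨M, (norm_nonneg _).trans (hM a (Metric.mem_closedBall_self (by positivity))),
    fun y hy y' hy' => (convex_closedBall a _).norm_image_sub_le_of_norm_fderiv_le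
    (fun p hp => ?_) hM hy hy'⟩
  exact (h1.differentiableOn one_ne_zero).differentiableAt
    (Metric.isOpen_ball.mem_nhds (hsub hp))

/-- **Bubble part of expansion (3.1) of Lemma 3.1.** For `Q ∈ C²(B_{2d}(a))`,
and sequences `x_n → a`, `λ_n → +∞`,
`λ_n² ∫_{B_d(x_n)} ((y-x_n)·∇Q(y)) U_{x_n,λ_n}(y)^{2*} dy
  → (N(N-2))^{N/2} (ΔQ(a)/N) ∫_{ℝ^N} |z|²(1+|z|²)^{-N} dz`. -/
theorem bubble_gradQ_expansion
    (N : ℕ) (hN : 3 ≤ N)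
    (a : EuclideanSpace ℝ (Fin N)) (d : ℝ) (hd : 0 < d)
    (Q : EuclideanSpace ℝ (Fin N) → ℝ)
    (hQ : ContDiffOn ℝ 2 Q (Metric.ball a (2 * d)))
    (x : ℕ → EuclideanSpace ℝ (Fin N)) (hx : Tendsto x atTop (nhds a))
    (lam : ℕ → ℝ) (hlam : Tendsto lam atTop atTop) :
    Tendsto
      (fun n => (lam n) ^ 2 *
        ∫ y in Metric.ball (x n) d,
          (fderiv ℝ Q y (y - x n)) * (bubble N (x n) (lam n) y) ^ twoStar N)
      atTop
      (nhds (((N : ℝ) * ((N : ℝ) - 2)) ^ ((N : ℝ) / 2) * (laplacian Q a / (N : ℝ)) *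
        ∫ z : EuclideanSpace ℝ (Fin N), ‖z‖ ^ 2 * (1 + ‖z‖ ^ 2) ^ (-(N : ℝ)))) := by
  have hball : Metric.ball a (2 * d) ∈ 𝓝 a := Metric.ball_mem_nhds a (by linarith)
  have hQa : ContDiffAt ℝ 1 (fderiv ℝ Q) a :=
    (hQ.contDiffAt hball).fderiv_right (by norm_num)
  obtain ⟨M, hMnn, hM⟩ := exists_norm_fderiv_sub_le hd hQ
  set w : EuclideanSpace ℝ (Fin N) → ℝ := fun z => (1 + ‖z‖ ^ 2) ^ (-(N : ℝ)) with hw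
  have hw0 : ∀ z, 0 ≤ w z := fun z => by positivity
  have hwm : Measurable w := by fun_prop
  have hwi : Integrable w := integrable_one_add_norm_sq_rpow hN
  have hw2 : Integrable fun z => ‖z‖ ^ 2 * w z := integrable_norm_sq_mul_rpow hN
  set F : ℕ → EuclideanSpace ℝ (Fin N) → ℝ := fun n =>
    (Metric.ball 0 (lam n * d)).indicator
      fun z => lam n * (fderiv ℝ Q (x n + (lam n)⁻¹ • z) z - fderiv ℝ Q (x n) z) * w z with hF
  have hFm : ∀ n, AEStronglyMeasurable (F n) := by
    intro n
    refine (Measurable.indicator ?_ measurableSet_ball).aestronglyMeasurable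
    have h1 : Measurable fun z => fderiv ℝ Q (x n + (lam n)⁻¹ • z) z :=
      isBoundedBilinearMap_apply.continuous.measurable.comp
        (((measurable_fderiv ℝ Q).comp (by fun_prop)).prodMk measurable_id)
    have h2 : Measurable fun z => fderiv ℝ Q (x n) z := (fderiv ℝ Q (x n)).measurable
    exact (measurable_const.mul (h1.sub h2)).mul hwm
  have hFb : ∀ᶠ n in atTop, ∀ z, ‖F n z‖ ≤ M * (‖z‖ ^ 2 * w z) := by
    filter_upwards [hx.eventually (Metric.ball_mem_nhds a (half_pos hd)),
      hlam.eventually_gt_atTop 0] with n hn hl z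
    have hM0 : 0 ≤ M * (‖z‖ ^ 2 * w z) :=
      mul_nonneg hMnn (mul_nonneg (sq_nonneg _) (hw0 z))
    by_cases hz : z ∈ Metric.ball 0 (lam n * d)
    · simp only [hF, Set.indicator_of_mem hz]
      have hn' : dist (x n) a < d / 2 := hn
      have hzn : ‖(lam n)⁻¹ • z‖ < d := by
        rw [norm_smul, norm_inv, Real.norm_of_nonneg hl.le, inv_mul_lt_iff₀ hl]
        simpa using hz
      have h := hM (x n) (by rw [Metric.mem_closedBall]; linarith) (x n + (lam n)⁻¹ • z) (by
        rw [Metric.mem_closedBall]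
        have := dist_triangle (x n + (lam n)⁻¹ • z) (x n) a
        rw [dist_self_add_left] at this
        linarith)
      rw [add_sub_cancel_left, norm_smul, norm_inv, Real.norm_of_nonneg hl.le] at h
      rw [norm_mul, norm_mul, Real.norm_of_nonneg hl.le, Real.norm_of_nonneg (hw0 z),
        ← mul_assoc, ← sub_apply]
      refine mul_le_mul_of_nonneg_right ?_ (hw0 z)
      calc lam n * ‖(fderiv ℝ Q (x n + (lam n)⁻¹ • z) - fderiv ℝ Q (x n)) z‖
          ≤ lam n * (M * ((lam n)⁻¹ * ‖z‖) * ‖z‖) := by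
            gcongr
            exact ContinuousLinearMap.le_of_opNorm_le _ h z
        _ = M * ‖z‖ ^ 2 := by field_simp
    · simpa only [hF, Set.indicator_of_notMem hz, norm_zero] using hM0
  have hlim : Tendsto (fun n => ∫ z, F n z) atTop
      (𝓝 (∫ z, fderiv ℝ (fderiv ℝ Q) a z z * w z)) := by
    refine tendsto_integral_filter_of_dominated_convergence (fun z => M * (‖z‖ ^ 2 * w z))
      (Eventually.of_forall hFm) (hFb.mono fun n hn => ae_of_all _ hn) (hw2.const_mul M)
      (ae_of_all _ fun z => ?_)
    have h1 := (hQa.hasStrictFDerivAt one_ne_zero).tendsto_smul_sub hx hlam z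
    have h2 := (((ContinuousLinearMap.apply ℝ ℝ z).continuous.tendsto _).comp h1).mul_const (w z)
    refine h2.congr' ?_
    filter_upwards [(hlam.atTop_mul_const hd).eventually_gt_atTop ‖z‖] with n hn
    have hz : z ∈ Metric.ball 0 (lam n * d) := by simpa using hn
    simp [hF, Set.indicator_of_mem hz]
  rw [integral_bilin_mul_radial (fun T z => by simp [hw]) hw2,
    ← laplacian_eq_sum_fderiv_fderiv (hQa.differentiableAt one_ne_zero)] at hlim
  rw [mul_assoc]
  refine (hlim.const_mul _).congr' ?_
  filter_upwards [hFb, hlam.eventually_gt_atTop 0] with n hn hl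
  rw [integral_ball_bubble hN Q (x n) d hl]
  congr 1
  have hFi : Integrable (F n) := (hw2.const_mul M).mono' (hFm n) (ae_of_all _ hn)
  have hLi : Integrable fun z => lam n * fderiv ℝ Q (x n) z * w z := by
    refine ((hwi.add hw2).const_mul (lam n * ‖fderiv ℝ Q (x n)‖)).mono'
      (Measurable.aestronglyMeasurable (by fun_prop)) (ae_of_all _ fun z => ?_)
    rw [norm_mul, norm_mul, Real.norm_of_nonneg hl.le, Real.norm_of_nonneg (hw0 z)]
    calc lam n * ‖fderiv ℝ Q (x n) z‖ * w z
        ≤ lam n * (‖fderiv ℝ Q (x n)‖ * (1 + ‖z‖ ^ 2)) * w z := by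
          have := hw0 z
          gcongr
          refine ((fderiv ℝ Q (x n)).le_opNorm z).trans ?_
          gcongr
          nlinarith [sq_nonneg (‖z‖ - 1)]
      _ = _ := by
          simp only [Pi.add_apply]
          ring
  have hodd : ∫ z in Metric.ball 0 (lam n * d), lam n * fderiv ℝ Q (x n) z * w z = 0 :=
    integral_ball_odd_eq_zero (fun z => by simp [hw]) _
  have hFi' := (integrable_indicator_iff measurableSet_ball).1 hFi
  rw [hF, integral_indicator measurableSet_ball, ← add_zero (∫ z in _, _), ← hodd,
    ← integral_add hFi' hLi.integrableOn]
  congr 1 with z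
  ring

end
end

section
/- Let N = 4 and let d > 0. Then for every x₀ ∈ ℝ⁴, (λ²/ log λ) ∫_{B_d(x₀)} U_{x₀,λ}(y)² dy → 16π² as λ → +∞, where U_{x₀,λ}(y) = (8)^{1/2} λ (1+λ²|y−x₀|²)^{−1} is the four-dimensional Aubin–Talenti bubble. -/
open MeasureTheory Metric Real Filter Topology Set

noncomputable section

/-- The radial integral of the squared four-dimensional bubble profile, in closed form. -/
lemma integral_radial_bubble_sq {d lam : ℝ} (hlam : 0 < lam) :
    ∫ r in (0 : ℝ)..d, r ^ 3 * (√8 * lam / (1 + lam ^ 2 * r ^ 2)) ^ 2 =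
      4 / lam ^ 2 * (Real.log (1 + lam ^ 2 * d ^ 2) + (1 + lam ^ 2 * d ^ 2)⁻¹ - 1) := by
  have hpos (r : ℝ) : 0 < 1 + lam ^ 2 * r ^ 2 := by positivity
  have hderiv (r : ℝ) : HasDerivAt
      (fun r ↦ 4 / lam ^ 2 * (Real.log (1 + lam ^ 2 * r ^ 2) + (1 + lam ^ 2 * r ^ 2)⁻¹))
      (r ^ 3 * (√8 * lam / (1 + lam ^ 2 * r ^ 2)) ^ 2) r := by
    have h1 : HasDerivAt (fun r : ℝ ↦ 1 + lam ^ 2 * r ^ 2) (lam ^ 2 * (2 * r)) r := by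
      simpa using ((hasDerivAt_pow 2 r).const_mul (lam ^ 2)).const_add 1
    have hne := (hpos r).ne'
    refine (((h1.log hne).add (h1.inv hne)).const_mul (4 / lam ^ 2)).congr_deriv ?_
    rw [div_pow, mul_pow, Real.sq_sqrt (by norm_num)]
    field_simp
    ring
  rw [intervalIntegral.integral_eq_sub_of_hasDerivAt (fun r _ ↦ hderiv r)]
  · simp
    ring
  · refine Continuous.intervalIntegrable ?_ _ _
    exact (continuous_pow 3).mul ((Continuous.div (by fun_prop) (by fun_prop)
      fun r ↦ (hpos r).ne').pow 2)

/-- Polar coordinates for radial functions on balls of `ℝ⁴`. -/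
lemma setIntegral_ball_norm_sub_dim4 {d : ℝ} (hd : 0 < d) (x₀ : EuclideanSpace ℝ (Fin 4))
    (f : ℝ → ℝ) :
    ∫ y in ball x₀ d, f ‖y - x₀‖ = 2 * π ^ 2 * ∫ r in (0 : ℝ)..d, r ^ 3 * f r := by
  have hvol : (volume : Measure (EuclideanSpace ℝ (Fin 4))).real (ball 0 1) = π ^ 2 / 2 := by
    rw [Measure.real, InnerProductSpace.volume_ball_of_dim_even (k := 2) (by simp)]
    simp [Nat.factorial]
    positivity
  have hind : (ball x₀ d).indicator (fun y ↦ f ‖y - x₀‖) =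
      fun y ↦ (Iio d).indicator f ‖y - x₀‖ := by
    ext y
    simp [indicator, dist_eq_norm]
  rw [← integral_indicator measurableSet_ball, hind,
    integral_sub_right_eq_self (fun y ↦ (Iio d).indicator f ‖y‖) x₀,
    integral_fun_norm_addHaar, hvol, intervalIntegral.integral_of_le hd.le,
    integral_Ioc_eq_integral_Ioo, ← Ioi_inter_Iio]
  have hprod : (fun r : ℝ ↦ r ^ (Module.finrank ℝ (EuclideanSpace ℝ (Fin 4)) - 1) •
      (Iio d).indicator f r) = (Iio d).indicator fun r ↦ r ^ 3 * f r := by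
    ext r
    simp [indicator]
  rw [hprod, setIntegral_indicator measurableSet_Iio]
  simp
  ring

/-- `log (1 + λ² d²)` grows like `2 log λ`. -/
lemma tendsto_log_one_add_sq_mul_sq_div_log {d : ℝ} (hd : 0 < d) :
    Tendsto (fun lam : ℝ ↦ Real.log (1 + lam ^ 2 * d ^ 2) / Real.log lam) atTop (𝓝 2) := by
  have h0 : Tendsto (fun lam : ℝ ↦ (lam ^ 2)⁻¹ + d ^ 2) atTop (𝓝 (0 + d ^ 2)) :=
    (tendsto_inv_atTop_zero.comp (tendsto_pow_atTop two_ne_zero)).add_const _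
  have h1 : Tendsto (fun lam : ℝ ↦ 2 + Real.log ((lam ^ 2)⁻¹ + d ^ 2) / Real.log lam) atTop
      (𝓝 (2 + 0)) :=
    ((h0.log (by positivity)).div_atTop Real.tendsto_log_atTop).const_add 2
  rw [add_zero] at h1
  refine h1.congr' ?_
  filter_upwards [eventually_gt_atTop 1] with lam hlam
  have hl : 0 < lam := by linarith
  have hlog : Real.log lam ≠ 0 := (Real.log_pos hlam).ne'
  have : 1 + lam ^ 2 * d ^ 2 = lam ^ 2 * ((lam ^ 2)⁻¹ + d ^ 2) := by field_simp
  rw [this, Real.log_mul (by positivity) (by positivity), Real.log_pow]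
  push_cast
  field_simp

/-- **Logarithmic case `N = 4`, `s = 1` of expansion (3.2) of Lemma 3.1.** For the
four-dimensional Aubin–Talenti bubble `U_{x₀,λ}(y) = √8 λ/(1+λ²|y-x₀|²)`,
`(λ²/log λ) ∫_{B_d(x₀)} U_{x₀,λ}² → 16π²` as `λ → +∞`. -/
theorem bubble_L2_log_expansion_dim4
    (d : ℝ) (hd : 0 < d) (x₀ : EuclideanSpace ℝ (Fin 4)) :
    Tendsto
      (fun lam : ℝ => lam ^ 2 / Real.log lam *
        ∫ y in Metric.ball x₀ d,
          (Real.sqrt 8 * lam / (1 + lam ^ 2 * ‖y - x₀‖ ^ 2)) ^ 2)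
      atTop (nhds (16 * Real.pi ^ 2)) := by
  have hgrow : Tendsto (fun lam : ℝ ↦ 1 + lam ^ 2 * d ^ 2) atTop atTop :=
    tendsto_atTop_add_const_left _ _
      ((tendsto_pow_atTop two_ne_zero).atTop_mul_const (by positivity))
  have hrest : Tendsto (fun lam : ℝ ↦ ((1 + lam ^ 2 * d ^ 2)⁻¹ - 1) / Real.log lam) atTop (𝓝 0) :=
    ((tendsto_inv_atTop_zero.comp hgrow).sub_const 1).div_atTop Real.tendsto_log_atTop
  have hlim := ((tendsto_log_one_add_sq_mul_sq_div_log hd).add hrest).const_mul (8 * π ^ 2)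
  rw [show 8 * π ^ 2 * (2 + 0) = 16 * π ^ 2 by ring] at hlim
  refine hlim.congr' ?_
  filter_upwards [eventually_gt_atTop 1] with lam hlam
  have hl : 0 < lam := by linarith
  have hlog : Real.log lam ≠ 0 := (Real.log_pos hlam).ne'
  rw [setIntegral_ball_norm_sub_dim4 hd x₀ fun r ↦ (√8 * lam / (1 + lam ^ 2 * r ^ 2)) ^ 2,
    integral_radial_bubble_sq hl]
  field_simp
  ring

end
end

section
/- Let N ≥ 3, 2* = 2N/(N−2), and let d > 0. There exists a constant C > 0 depending only on N and d such that for all x₁, x₂ ∈ ℝ^N with |x₁ − x₂| ≥ d and all λ₁, λ₂ ≥ 1, ∫_{ℝ^N} U_{x₁,λ₁}(y) · U_{x₂,λ₂}(y)^{2*−1} dy ≤ C (λ₁ λ₂)^{−(N−2)/2}. -/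
open MeasureTheory Metric Real Filter Topology Set

noncomputable section

lemma bubble_eq_rpow {N : ℕ} (x y : EuclideanSpace ℝ (Fin N)) {lam : ℝ} (h : 0 ≤ lam) :
    bubble N x lam y = ((N : ℝ) * ((N : ℝ) - 2)) ^ (((N : ℝ) - 2) / 4) *
      (lam / (1 + lam ^ 2 * ‖y - x‖ ^ 2)) ^ (((N : ℝ) - 2) / 2) := by
  rw [bubble, Real.div_rpow h (by positivity), mul_div_assoc]

lemma div_one_add_sq_le {lam r s : ℝ} (hlam : 0 < lam) (hs : 0 < s) (hsr : s ≤ r) :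
    lam / (1 + lam ^ 2 * r ^ 2) ≤ lam⁻¹ * (s ^ 2)⁻¹ := by
  have h2 : s ^ 2 ≤ r ^ 2 := by gcongr
  rw [← mul_inv, ← one_div, div_le_div_iff₀ (by positivity) (by positivity)]
  nlinarith [mul_le_mul_of_nonneg_left h2 (sq_nonneg lam)]

lemma rpow_div_one_add_sq_le {lam r s a : ℝ} (ha : 0 ≤ a) (hlam : 0 < lam) (hs : 0 < s)
    (hsr : s ≤ r) :
    (lam / (1 + lam ^ 2 * r ^ 2)) ^ a ≤ lam ^ (-a) * ((s ^ 2)⁻¹) ^ a := by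
  have h := Real.rpow_le_rpow (by positivity) (div_one_add_sq_le hlam hs hsr) ha
  rwa [Real.mul_rpow (by positivity) (by positivity), Real.inv_rpow hlam.le,
    ← Real.rpow_neg hlam.le] at h

/-- Local integrability of the singular kernel `|y|^{2-N}`. -/
lemma integrable_ite_norm_sq_inv_rpow {N : ℕ} (hN : 3 ≤ N) (R : ℝ) :
    Integrable (fun y : EuclideanSpace ℝ (Fin N) =>
      if ‖y‖ < R then ((‖y‖ ^ 2)⁻¹) ^ (((N : ℝ) - 2) / 2) else 0) := by
  have : Nonempty (Fin N) := ⟨⟨0, by omega⟩⟩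
  refine (integrable_fun_norm_addHaar (volume : Measure (EuclideanSpace ℝ (Fin N)))
    (f := fun s : ℝ => if s < R then ((s ^ 2)⁻¹) ^ (((N : ℝ) - 2) / 2) else 0)).2 ?_
  have hid : IntegrableOn (fun s : ℝ => s) (Ioo 0 R) :=
    (continuous_id.integrableOn_Icc (a := 0) (b := R)).mono_set Ioo_subset_Icc_self
  have hind : IntegrableOn ((Iio R).indicator fun s : ℝ => s) (Ioi 0) := by
    rw [IntegrableOn, integrable_indicator_iff measurableSet_Iio, IntegrableOn,
      Measure.restrict_restrict measurableSet_Iio, Set.inter_comm, Ioi_inter_Iio]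
    exact hid
  refine hind.congr_fun (fun s hs => ?_) measurableSet_Ioi
  have hs : 0 < s := hs
  by_cases hR : s < R
  · have hpow : ((s ^ 2)⁻¹) ^ (((N : ℝ) - 2) / 2) = s ^ (-((N : ℝ) - 2)) := by
      rw [Real.inv_rpow (by positivity), ← Real.rpow_natCast s 2, ← Real.rpow_mul hs.le,
        ← Real.rpow_neg hs.le]
      congr 1
      push_cast
      ring
    simp only [Set.indicator, Set.mem_Iio, hR, if_true, finrank_euclideanSpace, Fintype.card_fin,
      smul_eq_mul, hpow]
    rw [← Real.rpow_natCast s (N - 1), ← Real.rpow_add hs, Nat.cast_sub (by omega)]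
    conv_lhs => rw [← Real.rpow_one s]
    congr 1
    push_cast
    ring
  · simp [Set.indicator, hR]

/-- The dilation `λ^N g(λ(y - x))` has the same integral as `g`. -/
lemma integral_pow_mul_comp_smul_sub {N : ℕ} (g : EuclideanSpace ℝ (Fin N) → ℝ)
    (x : EuclideanSpace ℝ (Fin N)) {lam : ℝ} (hlam : 0 < lam) :
    ∫ y, lam ^ N * g (lam • (y - x)) = ∫ z, g z := by
  rw [integral_const_mul, integral_sub_right_eq_self (fun z => g (lam • z)) x,
    Measure.integral_comp_smul, finrank_euclideanSpace, Fintype.card_fin, smul_eq_mul,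
    abs_of_pos (by positivity), ← mul_assoc, mul_inv_cancel₀ (by positivity), one_mul]

/-- **Interaction estimate between two well-separated bubbles.** For `N ≥ 3` and `d > 0`,
there is `C > 0` (depending only on `N, d`) such that for all centers with
`|x₁ - x₂| ≥ d` and all `λ₁, λ₂ ≥ 1`,
`∫_{ℝ^N} U_{x₁,λ₁} U_{x₂,λ₂}^{2*-1} ≤ C (λ₁λ₂)^{-(N-2)/2}`. -/
theorem bubble_interaction_estimate
    (N : ℕ) (hN : 3 ≤ N) (d : ℝ) (hd : 0 < d) :
    ∃ C > 0, ∀ x₁ x₂ : EuclideanSpace ℝ (Fin N), d ≤ dist x₁ x₂ →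
      ∀ lam₁ lam₂ : ℝ, 1 ≤ lam₁ → 1 ≤ lam₂ →
        (∫ y : EuclideanSpace ℝ (Fin N),
            bubble N x₁ lam₁ y * bubble N x₂ lam₂ y ^ (twoStar N - 1))
          ≤ C * (lam₁ * lam₂) ^ (-(((N : ℝ) - 2) / 2)) := by
  have : Nonempty (Fin N) := ⟨⟨0, by omega⟩⟩
  have hN' : (3 : ℝ) ≤ N := by exact_mod_cast hN
  set a : ℝ := ((N : ℝ) - 2) / 2 with ha
  set b : ℝ := ((N : ℝ) + 2) / 2 with hb
  have ha0 : 0 < a := by linarith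
  have hb0 : 0 < b := by linarith
  have hap : a * (twoStar N - 1) = b := by
    have : (N : ℝ) - 2 ≠ 0 := by linarith
    rw [ha, hb, twoStar]
    field_simp
    ring
  set c : ℝ := ((N : ℝ) * ((N : ℝ) - 2)) ^ (((N : ℝ) - 2) / 4)
  have hc0 : 0 < c := Real.rpow_pos_of_pos (mul_pos (by linarith) (by linarith)) _
  set p : ℝ := twoStar N - 1
  let g : EuclideanSpace ℝ (Fin N) → ℝ := fun z => (1 + ‖z‖ ^ 2) ^ (-b)
  let h : EuclideanSpace ℝ (Fin N) → ℝ := fun z =>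
    if ‖z‖ < d / 2 then ((‖z‖ ^ 2)⁻¹) ^ a else 0
  have hg0 : ∀ z, 0 ≤ g z := fun z => by positivity
  have hh0 : ∀ z, 0 ≤ h z := fun z => by
    simp only [h]
    split_ifs <;> positivity
  have hg : Integrable g := by
    have := integrable_rpow_neg_one_add_norm_sq
      (μ := (volume : Measure (EuclideanSpace ℝ (Fin N)))) (r := (N : ℝ) + 2) (by simp)
    simpa only [neg_div] using this
  have hh : Integrable h := integrable_ite_norm_sq_inv_rpow hN (d / 2)
  set A : ℝ := (((d / 2) ^ 2)⁻¹) ^ a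
  set B : ℝ := (((d / 2) ^ 2)⁻¹) ^ b
  have hA0 : 0 ≤ A := by positivity
  have hB0 : 0 ≤ B := by positivity
  have hG0 : 0 ≤ ∫ z, g z := integral_nonneg hg0
  have hH0 : 0 ≤ ∫ z, h z := integral_nonneg hh0
  refine ⟨c * c ^ p * (A * (∫ z, g z) + B * ∫ z, h z) + 1, by positivity, ?_⟩
  intro x₁ x₂ hx lam₁ lam₂ hl₁ hl₂
  have hp₁ : 0 < lam₁ := by linarith
  have hp₂ : 0 < lam₂ := by linarith
  have hgx : Integrable fun y => lam₂ ^ N * g (lam₂ • (y - x₂)) :=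
    ((hg.comp_smul hp₂.ne').comp_sub_right x₂).const_mul _
  have hhx : Integrable fun y => h (y - x₁) := hh.comp_sub_right x₁
  have hpt : ∀ y, y ≠ x₁ → bubble N x₁ lam₁ y * bubble N x₂ lam₂ y ^ p ≤
      c * c ^ p * (lam₁ * lam₂) ^ (-a) *
        (A * (lam₂ ^ N * g (lam₂ • (y - x₂))) + B * h (y - x₁)) := by
    intro y hy
    set t₁ : ℝ := lam₁ / (1 + lam₁ ^ 2 * ‖y - x₁‖ ^ 2)
    set t₂ : ℝ := lam₂ / (1 + lam₂ ^ 2 * ‖y - x₂‖ ^ 2) with ht₂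
    have ht₂0 : 0 ≤ t₂ := by positivity
    have hprod : bubble N x₁ lam₁ y * bubble N x₂ lam₂ y ^ p = c * c ^ p * (t₁ ^ a * t₂ ^ b) := by
      rw [bubble_eq_rpow _ _ hp₁.le, bubble_eq_rpow _ _ hp₂.le,
        Real.mul_rpow hc0.le (by positivity), ← Real.rpow_mul ht₂0, hap]
      ring
    rw [hprod, mul_assoc (c * c ^ p), Real.mul_rpow hp₁.le hp₂.le]
    refine mul_le_mul_of_nonneg_left ?_ (by positivity)
    have hgy := hg0 (lam₂ • (y - x₂))
    have hhy := hh0 (y - x₁)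
    by_cases hfar : d / 2 ≤ ‖y - x₁‖
    · have h₂ : t₂ ^ b = lam₂ ^ (-a) * (lam₂ ^ N * g (lam₂ • (y - x₂))) := by
        simp only [g, norm_smul, Real.norm_eq_abs, mul_pow, sq_abs]
        rw [ht₂, Real.div_rpow hp₂.le (by positivity), Real.rpow_neg (x := 1 + _) (by positivity),
          ← mul_assoc, ← Real.rpow_natCast lam₂ N, ← Real.rpow_add hp₂, div_eq_mul_inv]
        congr 2
        rw [ha, hb]
        ring
      calc t₁ ^ a * t₂ ^ b
          ≤ (lam₁ ^ (-a) * A) * (lam₂ ^ (-a) * (lam₂ ^ N * g (lam₂ • (y - x₂)))) := by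
            rw [h₂]
            exact mul_le_mul_of_nonneg_right
              (rpow_div_one_add_sq_le ha0.le hp₁ (by positivity) hfar) (by positivity)
        _ = lam₁ ^ (-a) * lam₂ ^ (-a) * (A * (lam₂ ^ N * g (lam₂ • (y - x₂)))) := by ring
        _ ≤ _ := by
            gcongr
            exact le_add_of_nonneg_right (by positivity)
    · push Not at hfar
      have hfar₂ : d / 2 ≤ ‖y - x₂‖ := by
        have := dist_triangle_left x₁ x₂ y
        rw [dist_eq_norm y x₁, dist_eq_norm y x₂] at this
        linarith
      have hh_eq : h (y - x₁) = ((‖y - x₁‖ ^ 2)⁻¹) ^ a := if_pos hfar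
      have h₁ : t₁ ^ a ≤ lam₁ ^ (-a) * h (y - x₁) := by
        rw [hh_eq]
        exact rpow_div_one_add_sq_le ha0.le hp₁ (norm_pos_iff.2 (sub_ne_zero.2 hy)) le_rfl
      have h₂ : t₂ ^ b ≤ lam₂ ^ (-a) * B := by
        refine (rpow_div_one_add_sq_le hb0.le hp₂ (by positivity) hfar₂).trans ?_
        exact mul_le_mul_of_nonneg_right
          (Real.rpow_le_rpow_of_exponent_le hl₂ (by rw [ha, hb]; linarith)) hB0
      calc t₁ ^ a * t₂ ^ b ≤ (lam₁ ^ (-a) * h (y - x₁)) * (lam₂ ^ (-a) * B) :=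
            mul_le_mul h₁ h₂ (by positivity) (by positivity)
        _ = lam₁ ^ (-a) * lam₂ ^ (-a) * (B * h (y - x₁)) := by ring
        _ ≤ _ := by
            gcongr
            exact le_add_of_nonneg_left (by positivity)
  calc (∫ y, bubble N x₁ lam₁ y * bubble N x₂ lam₂ y ^ p)
      ≤ ∫ y, c * c ^ p * (lam₁ * lam₂) ^ (-a) *
          (A * (lam₂ ^ N * g (lam₂ • (y - x₂))) + B * h (y - x₁)) := by
        refine integral_mono_of_nonneg (Eventually.of_forall fun y => ?_)
          (((hgx.const_mul A).add (hhx.const_mul B)).const_mul _) ?_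
        · have hbub : ∀ x lam, 0 < lam → 0 ≤ bubble N x lam y := fun x lam hlam => by
            rw [bubble_eq_rpow _ _ hlam.le]
            positivity
          exact mul_nonneg (hbub _ _ hp₁) (Real.rpow_nonneg (hbub _ _ hp₂) _)
        · filter_upwards [Measure.ae_ne volume x₁] with y hy using hpt y hy
    _ = c * c ^ p * (A * (∫ z, g z) + B * ∫ z, h z) * (lam₁ * lam₂) ^ (-a) := by
        rw [integral_const_mul, integral_add (hgx.const_mul A) (hhx.const_mul B),
          integral_const_mul A, integral_const_mul B, integral_pow_mul_comp_smul_sub g x₂ hp₂,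
          integral_sub_right_eq_self h x₁]
        ring
    _ ≤ _ := by
        gcongr
        linarith

end
end

section
/- Let N ≥ 4, 2* = 2N/(N−2), m ≥ 2, d > 0 and κ ≥ 1. There exists C > 0 depending only on N, m, d, κ such that: for all points x₁,…,x_m ∈ ℝ^N with |x_i − x_j| ≥ d for i ≠ j, and all λ₁,…,λ_m ≥ 2 with max_j λ_j ≤ κ min_j λ_j, one has ( ∫_{ℝ^N} | (Σ_{j=1}^m U_{x_j,λ_j})^{2*−1} − Σ_{j=1}^m U_{x_j,λ_j}^{2*−1} |^{2N/(N+2)} dy )^{(N+2)/(2N)} ≤ C Σ_{j=1}^m (log λ_j)^{(N+2)/N} λ_j^{−(N+2)/2} if N ≥ 6, and ≤ C Σ_{j=1}^m λ_j^{−(N−2)} if N ∈ {4,5}. -/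
open MeasureTheory Metric Real Filter Topology Set

noncomputable section

theorem sum_rpow_le_rpow_sum {ι : Type*} [Fintype ι] {a : ι → ℝ} (ha : ∀ j, 0 ≤ a j)
    {p : ℝ} (hp : 1 ≤ p) : ∑ j, a j ^ p ≤ (∑ j, a j) ^ p := by
  have key : ∀ {x : ℝ}, 0 ≤ x → x ^ p = x * x ^ (p - 1) := fun hx => by
    rw [← Real.rpow_one_add' hx (by linarith)]; ring_nf
  rw [key (Finset.sum_nonneg fun j _ => ha j), Finset.sum_mul]
  refine Finset.sum_le_sum fun j _ => ?_
  rw [key (ha j)]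
  exact mul_le_mul_of_nonneg_left (Real.rpow_le_rpow (ha j)
    (Finset.single_le_sum (fun i _ => ha i) (Finset.mem_univ j)) (by linarith)) (ha j)

theorem rpow_sub_rpow_le {s a p : ℝ} (hs : 0 < s) (ha : 0 ≤ a) (hp : 1 ≤ p) :
    s ^ p - a ^ p ≤ p * s ^ (p - 1) * (s - a) := by
  have h := one_add_mul_self_le_rpow_one_add (s := a / s - 1)
    (by have := div_nonneg ha hs.le; linarith) hp
  rw [add_sub_cancel, Real.div_rpow ha hs.le, le_div_iff₀ (by positivity)] at h
  have h2 : s ^ p = s ^ (p - 1) * s := by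
    rw [← Real.rpow_add_one hs.ne']; ring_nf
  have h3 : (1 + p * (a / s - 1)) * s ^ p = s ^ p - p * s ^ (p - 1) * (s - a) := by
    rw [h2]; field_simp; ring
  linarith

theorem abs_rpow_sum_sub_sum_rpow_le {ι : Type*} [Fintype ι] {a : ι → ℝ} (ha : ∀ j, 0 < a j)
    {p : ℝ} (hp : 1 ≤ p) (k : ι) :
    |(∑ j, a j) ^ p - ∑ j, a j ^ p| ≤ p * (∑ j, a j) ^ (p - 1) * (∑ j, a j - a k) := by
  have hs : 0 < ∑ j, a j := Finset.sum_pos (fun j _ => ha j) ⟨k, Finset.mem_univ k⟩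
  rw [abs_of_nonneg (sub_nonneg.2 (sum_rpow_le_rpow_sum (fun j => (ha j).le) hp))]
  refine le_trans ?_ (rpow_sub_rpow_le hs (ha k).le hp)
  gcongr
  exact Finset.single_le_sum (f := fun j => a j ^ p)
    (fun i _ => Real.rpow_nonneg (ha i).le p) (Finset.mem_univ k)

theorem rpow_integral_le_of_forall_exists_le {ι E : Type*} [Fintype ι] [MeasurableSpace E]
    {μ : Measure E} {f : E → ℝ} {g : ι → E → ℝ} {h : ι → ℝ} {q A B : ℝ} (hq : 1 ≤ q)
    (hf : ∀ y, 0 ≤ f y) (hg : ∀ k y, 0 ≤ g k y) (hgi : ∀ k, Integrable (g k) μ)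
    (hh : ∀ k, 0 ≤ h k) (hA : 0 ≤ A) (hB : 0 ≤ B)
    (hfg : ∀ y, ∃ k, f y ^ q ≤ A * g k y) (hgh : ∀ k, ∫ y, g k y ∂μ ≤ B * h k ^ q) :
    (∫ y, f y ^ q ∂μ) ^ q⁻¹ ≤ (A * B) ^ q⁻¹ * ∑ k, h k := by
  have hS : 0 ≤ ∑ k, h k := Finset.sum_nonneg fun k _ => hh k
  have h1 : ∫ y, f y ^ q ∂μ ≤ A * B * (∑ k, h k) ^ q := by
    calc ∫ y, f y ^ q ∂μ ≤ ∫ y, A * ∑ k, g k y ∂μ := by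
          refine integral_mono_of_nonneg (.of_forall fun y => Real.rpow_nonneg (hf y) q)
            ((integrable_finsetSum _ fun k _ => hgi k).const_mul A) (.of_forall fun y => ?_)
          obtain ⟨k, hk⟩ := hfg y
          exact hk.trans (mul_le_mul_of_nonneg_left (Finset.single_le_sum
            (f := fun k => g k y) (fun i _ => hg i y) (Finset.mem_univ k)) hA)
      _ = A * ∑ k, ∫ y, g k y ∂μ := by
          rw [integral_const_mul, integral_finsetSum _ fun k _ => hgi k]
      _ ≤ A * ∑ k, B * h k ^ q := by gcongr with k; exact hgh k
      _ = A * B * ∑ k, h k ^ q := by rw [← Finset.mul_sum]; ring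
      _ ≤ A * B * (∑ k, h k) ^ q := by gcongr; exact sum_rpow_le_rpow_sum hh hq
  calc _ ≤ (A * B * (∑ k, h k) ^ q) ^ q⁻¹ := by
        refine Real.rpow_le_rpow (integral_nonneg fun y => Real.rpow_nonneg (hf y) q) h1 ?_
        positivity
    _ = _ := by
        rw [Real.mul_rpow (by positivity) (by positivity), Real.rpow_rpow_inv hS (by linarith)]

theorem setIntegral_Ioi_div_eq_log {l : ℝ} (hl : 1 ≤ l) :
    IntegrableOn (fun r : ℝ => (l - 1) / ((1 + l * r) * (1 + r))) (Ioi 0) ∧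
    ∫ r in Ioi (0 : ℝ), (l - 1) / ((1 + l * r) * (1 + r)) = log l := by
  have hd : ∀ r ∈ Ici (0 : ℝ), HasDerivAt (fun r : ℝ => log ((1 + l * r) / (1 + r)))
      ((l - 1) / ((1 + l * r) * (1 + r))) r := by
    intro r hr
    have hr : 0 ≤ r := hr
    have h1 : (1 + l * r) ≠ 0 := by positivity
    have h2 : (1 + r) ≠ 0 := by positivity
    have h3 : HasDerivAt (fun r : ℝ => 1 + l * r) l r := by
      simpa using ((hasDerivAt_id r).const_mul l).const_add 1
    have h4 : HasDerivAt (fun r : ℝ => 1 + r) 1 r := (hasDerivAt_id r).const_add 1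
    convert (h3.fun_div h4 h2).log (div_ne_zero h1 h2) using 1
    field_simp
    ring
  have hn : ∀ r ∈ Ioi (0 : ℝ), 0 ≤ (l - 1) / ((1 + l * r) * (1 + r)) := by
    intro r hr
    have hr : 0 < r := hr
    exact div_nonneg (by linarith) (by positivity)
  have ht : Tendsto (fun r : ℝ => log ((1 + l * r) / (1 + r))) atTop (𝓝 (log l)) := by
    refine Tendsto.log ?_ (by positivity)
    have h0 : Tendsto (fun r : ℝ => l - (l - 1) / (1 + r)) atTop (𝓝 (l - 0)) :=
      tendsto_const_nhds.sub ((tendsto_atTop_add_const_left _ 1 tendsto_id).const_div_atTop _)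
    rw [sub_zero] at h0
    refine h0.congr' ?_
    filter_upwards [eventually_ge_atTop 0] with r hr
    have h2 : (1 + r) ≠ 0 := by positivity
    field_simp
    ring
  refine ⟨integrableOn_Ioi_deriv_of_nonneg' hd hn ht, ?_⟩
  rw [integral_Ioi_of_hasDerivAt_of_nonneg' hd hn ht]
  simp

section Radial

variable {E : Type*} [NormedAddCommGroup E] [NormedSpace ℝ E] [FiniteDimensional ℝ E]
  [MeasurableSpace E] [BorelSpace E] (μ : Measure E) [μ.IsAddHaarMeasure]

theorem pow_mul_rpow_neg_le {n : ℕ} (hn : n ≠ 0) {l r : ℝ} (hl : 2 ≤ l) (hr : 0 ≤ r) :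
    r ^ (n - 1) * ((1 + l ^ 2 * r ^ 2) * (1 + r ^ 2)) ^ (-((n : ℝ) / 2)) ≤
      2 ^ (n + 1) / l ^ n * ((l - 1) / ((1 + l * r) * (1 + r))) := by
  obtain ⟨k, rfl⟩ : ∃ k, n = k + 1 := ⟨n - 1, by omega⟩
  have hl0 : 0 < l := by linarith
  set u := 1 + l * r with hu
  set v := 1 + r with hv
  have hu1 : 0 < u := by positivity
  have hv1 : 1 ≤ v := by linarith
  have h1 : (u * v / 2) ^ 2 ≤ (1 + l ^ 2 * r ^ 2) * (1 + r ^ 2) := by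
    have e1 : u ^ 2 / 2 ≤ 1 + l ^ 2 * r ^ 2 := by nlinarith [sq_nonneg (1 - l * r)]
    have e2 : v ^ 2 / 2 ≤ 1 + r ^ 2 := by nlinarith [sq_nonneg (1 - r)]
    calc (u * v / 2) ^ 2 = (u ^ 2 / 2) * (v ^ 2 / 2) := by ring
      _ ≤ _ := by gcongr
  have h2 : ((1 + l ^ 2 * r ^ 2) * (1 + r ^ 2)) ^ (-(((k + 1 : ℕ) : ℝ) / 2)) ≤
      2 ^ (k + 1) / (u * v) ^ (k + 1) := by
    calc _ ≤ ((u * v / 2) ^ 2) ^ (-(((k + 1 : ℕ) : ℝ) / 2)) :=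
          Real.rpow_le_rpow_of_nonpos (by positivity) h1
            (neg_nonpos.2 (by positivity))
      _ = (u * v / 2) ^ (-((k + 1 : ℕ) : ℝ)) := by
          rw [← Real.rpow_natCast, ← Real.rpow_mul (by positivity)]
          congr 1
          push_cast
          ring
      _ = 2 ^ (k + 1) / (u * v) ^ (k + 1) := by
          rw [Real.rpow_neg (by positivity), Real.rpow_natCast, div_pow, inv_div]
  have h3 : r ^ k ≤ u ^ k * v ^ k / l ^ k := by
    rw [le_div_iff₀ (by positivity), ← mul_pow, ← mul_pow]
    have : r * l ≤ u * v := by nlinarith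
    gcongr
  calc r ^ (k + 1 - 1) * ((1 + l ^ 2 * r ^ 2) * (1 + r ^ 2)) ^ (-(((k + 1 : ℕ) : ℝ) / 2))
      ≤ (u ^ k * v ^ k / l ^ k) * (2 ^ (k + 1) / (u * v) ^ (k + 1)) := by
        rw [Nat.add_sub_cancel]
        gcongr
    _ = 2 ^ (k + 1) / l ^ (k + 1) * (l / (u * v)) := by
        rw [mul_pow, pow_succ u, pow_succ v, pow_succ l]
        field_simp
    _ ≤ 2 ^ (k + 1) / l ^ (k + 1) * (2 * (l - 1) / (u * v)) := by
        gcongr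
        linarith
    _ = _ := by rw [pow_succ 2 (k + 1)]; ring

theorem exists_integral_rpow_neg_le_log [Nontrivial E] :
    ∃ C > 0, ∀ l : ℝ, 2 ≤ l →
      Integrable (fun z : E => ((1 + l ^ 2 * ‖z‖ ^ 2) * (1 + ‖z‖ ^ 2)) ^
        (-((Module.finrank ℝ E : ℝ) / 2))) μ ∧
      ∫ z : E, ((1 + l ^ 2 * ‖z‖ ^ 2) * (1 + ‖z‖ ^ 2)) ^
        (-((Module.finrank ℝ E : ℝ) / 2)) ∂μ ≤
        C * (l ^ (-(Module.finrank ℝ E : ℝ)) * log l) := by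
  set n := Module.finrank ℝ E with hn
  have hn0 : n ≠ 0 := Module.finrank_pos.ne'
  have hb : 0 < μ.real (ball 0 1) :=
    ENNReal.toReal_pos (measure_ball_pos μ 0 one_pos).ne' measure_ball_lt_top.ne
  refine ⟨n * μ.real (ball 0 1) * 2 ^ (n + 1), by positivity, fun l hl => ?_⟩
  have hl0 : 0 < l := by linarith
  obtain ⟨hi, he⟩ := setIntegral_Ioi_div_eq_log (l := l) (by linarith)
  set φ : ℝ → ℝ := fun r => ((1 + l ^ 2 * r ^ 2) * (1 + r ^ 2)) ^ (-((n : ℝ) / 2)) with hφ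
  have hφi : IntegrableOn (fun r : ℝ => r ^ (n - 1) • φ r) (Ioi 0) := by
    refine (hi.const_mul (2 ^ (n + 1) / l ^ n)).mono' (by fun_prop) ?_
    filter_upwards [ae_restrict_mem measurableSet_Ioi] with r hr
    have hr : 0 < r := hr
    rw [Real.norm_of_nonneg (by positivity), smul_eq_mul]
    exact pow_mul_rpow_neg_le hn0 hl hr.le
  refine ⟨(integrable_fun_norm_addHaar μ (f := φ)).2 hφi, ?_⟩
  rw [integral_fun_norm_addHaar μ φ]
  have h1 : ∫ r in Ioi (0 : ℝ), r ^ (n - 1) • φ r ≤ 2 ^ (n + 1) / l ^ n * log l := by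
    rw [← he, ← integral_const_mul]
    refine setIntegral_mono_on hφi (hi.const_mul _) measurableSet_Ioi fun r hr => ?_
    exact pow_mul_rpow_neg_le hn0 hl (le_of_lt hr)
  rw [nsmul_eq_mul, smul_eq_mul, Real.rpow_neg hl0.le, Real.rpow_natCast]
  calc _ ≤ n * (μ.real (ball 0 1) * (2 ^ (n + 1) / l ^ n * log l)) := by gcongr
    _ = _ := by ring

theorem integral_one_add_sq_mul_norm_sq_rpow_neg {r : ℝ} (hr : (Module.finrank ℝ E : ℝ) < r)
    {l : ℝ} (hl : 0 < l) :
    Integrable (fun z : E => (1 + l ^ 2 * ‖z‖ ^ 2) ^ (-r / 2)) μ ∧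
      ∫ z : E, (1 + l ^ 2 * ‖z‖ ^ 2) ^ (-r / 2) ∂μ =
        l ^ (-(Module.finrank ℝ E : ℝ)) * ∫ z : E, (1 + ‖z‖ ^ 2) ^ (-r / 2) ∂μ := by
  have h : (fun z : E => (1 + l ^ 2 * ‖z‖ ^ 2) ^ (-r / 2)) =
      fun z : E => (1 + ‖l • z‖ ^ 2) ^ (-r / 2) := by
    ext z
    rw [norm_smul, Real.norm_of_nonneg hl.le, mul_pow]
  rw [h]
  refine ⟨(integrable_rpow_neg_one_add_norm_sq (μ := μ) hr).comp_smul hl.ne', ?_⟩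
  rw [Measure.integral_comp_smul_of_nonneg μ (fun z : E => (1 + ‖z‖ ^ 2) ^ (-r / 2)) l
    (hR := hl.le), smul_eq_mul, Real.rpow_neg hl.le, Real.rpow_natCast]

end Radial

theorem bubble_eq {N : ℕ} (x : EuclideanSpace ℝ (Fin N)) {l : ℝ} (hl : 0 ≤ l)
    (y : EuclideanSpace ℝ (Fin N)) :
    bubble N x l y = ((N : ℝ) * ((N : ℝ) - 2)) ^ (((N : ℝ) - 2) / 4) *
      (l / (1 + l ^ 2 * ‖y - x‖ ^ 2)) ^ (((N : ℝ) - 2) / 2) := by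
  rw [bubble, Real.div_rpow hl (by positivity), mul_div_assoc]

theorem div_one_add_sq_le_s14 {l l' r r' κ : ℝ} (hl : 0 < l) (hl' : 0 < l') (hκ : 1 ≤ κ)
    (h : l' ≤ κ * l) (h' : l ≤ κ * l') (hr : 0 ≤ r) (hrr : r ≤ r') :
    l' / (1 + l' ^ 2 * r' ^ 2) ≤ κ * (l / (1 + l ^ 2 * r ^ 2)) := by
  rw [← mul_div_assoc, div_le_div_iff₀ (by positivity) (by positivity)]
  have e : l' * l * (l * r ^ 2) ≤ l' * l * (κ * l' * r' ^ 2) := by gcongr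
  nlinarith

theorem div_one_add_sq_le_div {l l' r r' κ d : ℝ} (hl : 0 < l) (hl' : 0 < l') (hd : 0 < d)
    (h' : l ≤ κ * l') (hr : 0 ≤ r) (hrr : r ≤ r') (hdr : d ≤ r + r') (hκ : 0 < κ) :
    l' / (1 + l' ^ 2 * r' ^ 2) ≤ κ * (1 + 4 / d ^ 2) * (1 / (l * (1 + r ^ 2))) := by
  have hr' : 0 < r' := by linarith
  have e1 : 1 + r ^ 2 ≤ (1 + 4 / d ^ 2) * r' ^ 2 := by
    have : 1 ≤ 4 / d ^ 2 * r' ^ 2 := by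
      rw [div_mul_eq_mul_div, le_div_iff₀ (by positivity)]
      nlinarith
    nlinarith
  calc l' / (1 + l' ^ 2 * r' ^ 2) ≤ l' / (l' ^ 2 * r' ^ 2) := by
        gcongr
        linarith
    _ = 1 / (l' * r' ^ 2) := by field_simp
    _ ≤ κ * (1 + 4 / d ^ 2) * (1 / (l * (1 + r ^ 2))) := by
        rw [mul_one_div, div_le_div_iff₀ (by positivity) (by positivity)]
        calc 1 * (l * (1 + r ^ 2)) ≤ (κ * l') * ((1 + 4 / d ^ 2) * r' ^ 2) := by
              rw [one_mul]; gcongr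
          _ = _ := by ring

theorem exists_abs_sub_le_of_separated {N m : ℕ} (hN : 2 < N) (hm : 0 < m) {d κ : ℝ}
    (hd : 0 < d) (hκ : 1 ≤ κ) :
    ∃ A > 0, ∀ x : Fin m → EuclideanSpace ℝ (Fin N),
      (∀ i j, i ≠ j → d ≤ dist (x i) (x j)) →
      ∀ lam : Fin m → ℝ, (∀ j, 0 < lam j) → (∀ i j, lam i ≤ κ * lam j) → ∀ y, ∃ k,
        |(∑ j, bubble N (x j) (lam j) y) ^ (twoStar N - 1)
          - ∑ j, bubble N (x j) (lam j) y ^ (twoStar N - 1)| ≤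
        A * ((lam k / (1 + lam k ^ 2 * ‖y - x k‖ ^ 2)) ^ (2 : ℝ) *
          min (lam k / (1 + lam k ^ 2 * ‖y - x k‖ ^ 2)) (1 / (lam k * (1 + ‖y - x k‖ ^ 2))) ^
            (((N : ℝ) - 2) / 2)) := by
  have hN' : (2 : ℝ) < N := by exact_mod_cast hN
  have hn : 0 < ((N : ℝ) - 2) / 2 := by linarith
  set n : ℝ := ((N : ℝ) - 2) / 2 with hn_def
  set c : ℝ := ((N : ℝ) * ((N : ℝ) - 2)) ^ (((N : ℝ) - 2) / 4) with hc_def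
  have hc : 0 < c := Real.rpow_pos_of_pos (mul_pos (by linarith) (by linarith)) _
  set p := twoStar N - 1 with hp_def
  have hpn : n * (p - 1) = 2 := by
    rw [hp_def, hn_def, twoStar]
    have : (N : ℝ) - 2 ≠ 0 := by linarith
    field_simp
    ring
  have hp : 1 ≤ p := by
    by_contra! h
    nlinarith
  set B := κ * (1 + 4 / d ^ 2) with hB_def
  have hBκ : κ ≤ B := le_mul_of_one_le_right (by linarith) (by
    have : 0 < 4 / d ^ 2 := by positivity
    linarith)
  have hB : 1 ≤ B := hκ.trans hBκ
  have hB0 : 0 < B := by linarith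
  have hm' : (0 : ℝ) < m := by exact_mod_cast hm
  set M := (m : ℝ) * (c * B ^ n) with hM_def
  have hM : 0 < M := by positivity
  refine ⟨p * M ^ (p - 1) * M, by positivity, fun x hx lam hlam hκl y => ?_⟩
  obtain ⟨k, -, hk⟩ := Finset.exists_min_image Finset.univ (fun k => ‖y - x k‖)
    ⟨⟨0, hm⟩, Finset.mem_univ _⟩
  refine ⟨k, ?_⟩
  set w : Fin m → ℝ := fun j => lam j / (1 + lam j ^ 2 * ‖y - x j‖ ^ 2) with hw_def
  set v : ℝ := 1 / (lam k * (1 + ‖y - x k‖ ^ 2)) with hv_def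
  have hw : ∀ j, 0 < w j := fun j => div_pos (hlam j) (by positivity)
  have hv : 0 < v := one_div_pos.2 (mul_pos (hlam k) (by positivity))
  have hwk : ∀ j, w j ≤ B * w k := fun j =>
    (div_one_add_sq_le_s14 (hlam k) (hlam j) hκ (hκl j k) (hκl k j) (norm_nonneg _)
      (hk j (Finset.mem_univ j))).trans (mul_le_mul_of_nonneg_right hBκ (hw k).le)
  have hwv : ∀ j, j ≠ k → w j ≤ B * v := fun j hj => by
    refine div_one_add_sq_le_div (hlam k) (hlam j) hd (hκl k j) (norm_nonneg _)
      (hk j (Finset.mem_univ j)) ((hx j k hj).trans ?_) (by linarith)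
    rw [add_comm, ← dist_eq_norm, ← dist_eq_norm, dist_comm y (x j)]
    exact dist_triangle _ _ _
  have hab : ∀ j, bubble N (x j) (lam j) y = c * w j ^ n := fun j =>
    bubble_eq (x j) (hlam j).le y
  simp only [hab]
  have ha : ∀ j, 0 < c * w j ^ n := fun j => mul_pos hc (Real.rpow_pos_of_pos (hw j) n)
  have hmin : 0 < min (w k) v := lt_min (hw k) hv
  have hsum : ∀ (s : Finset (Fin m)) (t : ℝ), 0 < t → (∀ j ∈ s, w j ≤ B * t) →
      ∑ j ∈ s, c * w j ^ n ≤ M * t ^ n := fun s t ht h => by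
    calc ∑ j ∈ s, c * w j ^ n ≤ ∑ j ∈ s, c * (B * t) ^ n := by
          gcongr with j hj
          · exact (hw j).le
          · exact h j hj
      _ = s.card * (c * B ^ n * t ^ n) := by
          rw [Finset.sum_const, nsmul_eq_mul, Real.mul_rpow hB0.le ht.le, mul_assoc c]
      _ ≤ m * (c * B ^ n * t ^ n) := by
          gcongr
          simpa using s.card_le_univ
      _ = M * t ^ n := by rw [hM_def]; ring
  have hS : ∑ j, c * w j ^ n ≤ M * w k ^ n := hsum _ _ (hw k) fun j _ => hwk j
  have hT : ∑ j, c * w j ^ n - c * w k ^ n ≤ M * min (w k) v ^ n := by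
    rw [← Finset.sum_erase_eq_sub (Finset.mem_univ k)]
    refine hsum _ _ hmin fun j hj => ?_
    rw [mul_min_of_nonneg _ _ hB0.le]
    exact le_min (hwk j) (hwv j (Finset.ne_of_mem_erase hj))
  have hT0 : 0 ≤ ∑ j, c * w j ^ n - c * w k ^ n := sub_nonneg.2 <|
    Finset.single_le_sum (f := fun j => c * w j ^ n) (fun j _ => (ha j).le) (Finset.mem_univ k)
  have hS0 : 0 ≤ ∑ j, c * w j ^ n := Finset.sum_nonneg fun j _ => (ha j).le
  calc _ ≤ p * (∑ j, c * w j ^ n) ^ (p - 1) * (∑ j, c * w j ^ n - c * w k ^ n) :=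
        abs_rpow_sum_sub_sum_rpow_le ha hp k
    _ ≤ p * (M * w k ^ n) ^ (p - 1) * (M * min (w k) v ^ n) := by
        gcongr
        exact mul_nonneg (by linarith)
          (Real.rpow_nonneg (mul_nonneg hM.le (Real.rpow_nonneg (hw k).le n)) _)
    _ = p * M ^ (p - 1) * M * (w k ^ (2 : ℝ) * min (w k) v ^ n) := by
        rw [Real.mul_rpow hM.le (Real.rpow_nonneg (hw k).le n), ← Real.rpow_mul (hw k).le, hpn]
        ring

theorem rpow_two_mul_min_rpow_le {w v n : ℝ} (hw : 0 < w) (hv : 0 < v) (hn : 2 ≤ n) :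
    w ^ (2 : ℝ) * min w v ^ n ≤ (w * v) ^ ((n + 2) / 2) := by
  have hmin : 0 < min w v := lt_min hw hv
  calc w ^ (2 : ℝ) * min w v ^ n
      = w ^ (2 : ℝ) * min w v ^ ((n - 2) / 2) * min w v ^ ((n + 2) / 2) := by
        rw [mul_assoc, ← Real.rpow_add hmin]
        ring_nf
    _ ≤ w ^ (2 : ℝ) * w ^ ((n - 2) / 2) * v ^ ((n + 2) / 2) := by
        have h1 := Real.rpow_le_rpow hmin.le (min_le_left w v) (by linarith : 0 ≤ (n - 2) / 2)
        have h2 := Real.rpow_le_rpow hmin.le (min_le_right w v) (by linarith : 0 ≤ (n + 2) / 2)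
        gcongr
    _ = (w * v) ^ ((n + 2) / 2) := by
        rw [← Real.rpow_add hw, Real.mul_rpow hw.le hv.le]
        ring_nf

/-- **Estimate (3.14) (bubble version).** For `N ≥ 4`, `m ≥ 2`, `d > 0`, `κ ≥ 1`, there is
`C > 0` (depending only on `N, m, d, κ`) such that: for centers `x_1, …, x_m` with mutual
distances at least `d` and heights `λ_1, …, λ_m ≥ 2` with `max λ ≤ κ min λ`, the
`L^{2N/(N+2)}`-norm of `(Σ_j U_{x_j,λ_j})^{2*-1} - Σ_j U_{x_j,λ_j}^{2*-1}` is at most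
`C Σ_j (log λ_j)^{(N+2)/N} λ_j^{-(N+2)/2}` if `N ≥ 6`, and at most
`C Σ_j λ_j^{-(N-2)}` if `N ∈ {4,5}`. -/
theorem multibubble_interaction_Lnorm_estimate
    (N : ℕ) (hN : 4 ≤ N) (m : ℕ) (hm : 2 ≤ m) (d κ : ℝ) (hd : 0 < d) (hκ : 1 ≤ κ) :
    ∃ C > 0, ∀ x : Fin m → EuclideanSpace ℝ (Fin N),
      (∀ i j, i ≠ j → d ≤ dist (x i) (x j)) →
      ∀ lam : Fin m → ℝ, (∀ j, 2 ≤ lam j) → (∀ i j, lam i ≤ κ * lam j) →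
        (6 ≤ N →
          (∫ y : EuclideanSpace ℝ (Fin N),
              |(∑ j, bubble N (x j) (lam j) y) ^ (twoStar N - 1)
                - ∑ j, bubble N (x j) (lam j) y ^ (twoStar N - 1)| ^
                ((2 * (N : ℝ)) / ((N : ℝ) + 2))) ^ (((N : ℝ) + 2) / (2 * (N : ℝ)))
            ≤ C * ∑ j, Real.log (lam j) ^ (((N : ℝ) + 2) / (N : ℝ)) *
                lam j ^ (-(((N : ℝ) + 2) / 2))) ∧
        (N < 6 →
          (∫ y : EuclideanSpace ℝ (Fin N),
              |(∑ j, bubble N (x j) (lam j) y) ^ (twoStar N - 1)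
                - ∑ j, bubble N (x j) (lam j) y ^ (twoStar N - 1)| ^
                ((2 * (N : ℝ)) / ((N : ℝ) + 2))) ^ (((N : ℝ) + 2) / (2 * (N : ℝ)))
            ≤ C * ∑ j, lam j ^ (-((N : ℝ) - 2))) := by
  have hN0 : (4 : ℝ) ≤ N := by exact_mod_cast hN
  obtain ⟨A, hA, hAb⟩ := exists_abs_sub_le_of_separated (N := N) (m := m) (by omega) (by omega)
    hd hκ
  have hfin : Module.finrank ℝ (EuclideanSpace ℝ (Fin N)) = N := finrank_euclideanSpace_fin
  set q : ℝ := (2 * (N : ℝ)) / ((N : ℝ) + 2) with hq_def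
  have hqi : ((N : ℝ) + 2) / (2 * (N : ℝ)) = q⁻¹ := by rw [hq_def, inv_div]
  have hq1 : 1 ≤ q := by
    rw [hq_def, le_div_iff₀ (by linarith)]
    linarith
  have hq0 : 0 ≤ q := by linarith
  rw [hqi]
  by_cases h6 : 6 ≤ N
  · have hN6 : (6 : ℝ) ≤ N := by exact_mod_cast h6
    have : Nontrivial (EuclideanSpace ℝ (Fin N)) :=
      Module.nontrivial_of_finrank_pos (R := ℝ) (by omega)
    obtain ⟨K, hK, hKb⟩ := exists_integral_rpow_neg_le_log
      (volume : Measure (EuclideanSpace ℝ (Fin N)))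
    rw [hfin] at hKb
    have hlog2 : 0 < log 2 := log_pos (by norm_num)
    refine ⟨(A ^ q * (K / log 2)) ^ q⁻¹, by positivity, fun x hx lam hlam hκl =>
      ⟨fun _ => ?_, fun h => absurd h (by omega)⟩⟩
    have hl0 : ∀ k, 0 < lam k := fun k => by linarith [hlam k]
    have hlog : ∀ k, log 2 ≤ log (lam k) := fun k => log_le_log (by norm_num) (hlam k)
    have hlog0 : ∀ k, 0 ≤ log (lam k) := fun k => hlog2.le.trans (hlog k)
    refine rpow_integral_le_of_forall_exists_le
      (g := fun k y => ((1 + lam k ^ 2 * ‖y - x k‖ ^ 2) * (1 + ‖y - x k‖ ^ 2)) ^ (-((N : ℝ) / 2)))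
      hq1 (fun y => abs_nonneg _) (fun k y => by positivity)
      (fun k => (hKb (lam k) (hlam k)).1.comp_sub_right (x k))
      (fun k => mul_nonneg (Real.rpow_nonneg (hlog0 k) _) (Real.rpow_nonneg (hl0 k).le _))
      (by positivity) (by positivity) (fun y => ?_) (fun k => ?_)
    · obtain ⟨k, hk⟩ := hAb x hx lam hl0 hκl y
      refine ⟨k, (Real.rpow_le_rpow (abs_nonneg _) hk hq0).trans ?_⟩
      have hl := hl0 k
      rw [Real.mul_rpow hA.le (by positivity)]
      gcongr
      refine (Real.rpow_le_rpow (by positivity) (rpow_two_mul_min_rpow_le (by positivity)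
        (by positivity) (by linarith)) hq0).trans_eq ?_
      rw [← Real.rpow_mul (by positivity), Real.rpow_neg (by positivity),
        ← Real.inv_rpow (by positivity)]
      congr 1
      · field_simp
      · rw [hq_def]
        field_simp
        ring
    · rw [integral_sub_right_eq_self (fun y => ((1 + lam k ^ 2 * ‖y‖ ^ 2) * (1 + ‖y‖ ^ 2)) ^
        (-((N : ℝ) / 2))) (x k)]
      refine (hKb (lam k) (hlam k)).2.trans ?_
      have e : (log (lam k) ^ (((N : ℝ) + 2) / N) * lam k ^ (-(((N : ℝ) + 2) / 2))) ^ q =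
          log (lam k) ^ 2 * lam k ^ (-(N : ℝ)) := by
        rw [Real.mul_rpow (Real.rpow_nonneg (hlog0 k) _) (Real.rpow_nonneg (hl0 k).le _),
          ← Real.rpow_mul (hlog0 k), ← Real.rpow_mul (hl0 k).le, ← Real.rpow_natCast]
        congr 2
        · rw [hq_def]
          field_simp
          norm_num
        · rw [hq_def]
          field_simp
      have hl := Real.rpow_pos_of_pos (hl0 k) (-(N : ℝ))
      rw [e, div_mul_eq_mul_div, le_div_iff₀ hlog2]
      calc K * (lam k ^ (-(N : ℝ)) * log (lam k)) * log 2
          ≤ K * (lam k ^ (-(N : ℝ)) * log (lam k)) * log (lam k) :=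
            mul_le_mul_of_nonneg_left (hlog k)
              (mul_nonneg hK.le (mul_nonneg hl.le (hlog0 k)))
        _ = _ := by ring
  · have hN6 : (N : ℝ) + 1 ≤ 6 := by exact_mod_cast (by omega : N + 1 ≤ 6)
    have hr : (Module.finrank ℝ (EuclideanSpace ℝ (Fin N)) : ℝ) < 4 * q := by
      rw [hfin, hq_def, ← mul_div_assoc, lt_div_iff₀ (by linarith)]
      nlinarith
    have hKb := fun l (hl : 0 < l) => integral_one_add_sq_mul_norm_sq_rpow_neg
      (volume : Measure (EuclideanSpace ℝ (Fin N))) hr hl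
    rw [hfin] at hKb
    set K := ∫ z : EuclideanSpace ℝ (Fin N), (1 + ‖z‖ ^ 2) ^ (-(4 * q) / 2)
    have hK : 0 ≤ K := integral_nonneg fun z => by positivity
    refine ⟨(A ^ q * (K + 1)) ^ q⁻¹, by positivity, fun x hx lam hlam hκl =>
      ⟨fun h => absurd h h6, fun _ => ?_⟩⟩
    have hl0 : ∀ k, 0 < lam k := fun k => by linarith [hlam k]
    refine rpow_integral_le_of_forall_exists_le
      (g := fun k y => lam k ^ ((2 - ((N : ℝ) - 2) / 2) * q) *
        (1 + lam k ^ 2 * ‖y - x k‖ ^ 2) ^ (-(4 * q) / 2))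
      hq1 (fun y => abs_nonneg _)
      (fun k y => mul_nonneg (Real.rpow_nonneg (hl0 k).le _) (by positivity))
      (fun k => ((hKb (lam k) (hl0 k)).1.comp_sub_right (x k)).const_mul _)
      (fun k => Real.rpow_nonneg (hl0 k).le _)
      (by positivity) (by positivity) (fun y => ?_) (fun k => ?_)
    · obtain ⟨k, hk⟩ := hAb x hx lam hl0 hκl y
      refine ⟨k, (Real.rpow_le_rpow (abs_nonneg _) hk hq0).trans ?_⟩
      have hl := hl0 k
      rw [Real.mul_rpow hA.le (by positivity)]
      gcongr
      have hv : min (lam k / (1 + lam k ^ 2 * ‖y - x k‖ ^ 2))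
          (1 / (lam k * (1 + ‖y - x k‖ ^ 2))) ≤ (lam k)⁻¹ := by
        refine (min_le_right _ _).trans ?_
        rw [inv_eq_one_div]
        gcongr
        exact le_mul_of_one_le_right hl.le (by linarith [sq_nonneg ‖y - x k‖])
      calc _ ≤ ((lam k / (1 + lam k ^ 2 * ‖y - x k‖ ^ 2)) ^ (2 : ℝ) *
            (lam k)⁻¹ ^ (((N : ℝ) - 2) / 2)) ^ q := by
            gcongr
            linarith
        _ = (lam k ^ (2 - ((N : ℝ) - 2) / 2) *
              (1 + lam k ^ 2 * ‖y - x k‖ ^ 2) ^ (-2 : ℝ)) ^ q := by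
            rw [Real.div_rpow hl.le (by positivity), Real.inv_rpow hl.le, Real.rpow_sub hl,
              Real.rpow_neg (by positivity)]
            ring_nf
        _ = _ := by
            rw [Real.mul_rpow (by positivity) (by positivity), ← Real.rpow_mul hl.le,
              ← Real.rpow_mul (by positivity)]
            ring_nf
    · rw [integral_const_mul, integral_sub_right_eq_self
        (fun y => (1 + lam k ^ 2 * ‖y‖ ^ 2) ^ (-(4 * q) / 2)) (x k), (hKb (lam k) (hl0 k)).2,
        ← mul_assoc, ← Real.rpow_add (hl0 k), ← Real.rpow_mul (hl0 k).le, mul_comm]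
      have e : (2 - ((N : ℝ) - 2) / 2) * q + -N = -((N : ℝ) - 2) * q := by
        rw [hq_def]
        field_simp
        ring
      rw [e]
      have hl := Real.rpow_pos_of_pos (hl0 k) (-((N : ℝ) - 2) * q)
      gcongr
      linarith

end
end
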